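/- Let f ≥ 2 be an integer, q = 2^f, S = PSL₂(q), and let G be a finite group with G/R(G) ≅ S. Suppose the induced subgraph of Δ(G) on π(S) equals Δ(S), i.e. for all distinct primes x, y dividing |S|, xy divides some member of cd(G) if and only if xy divides some member of cd(S). Then G ≅ S × R(G). -/

import Mathlib

open CategoryTheory

/-- `cd(G)`: the set of character degrees of `G`, i.e. the dimensions of the simple
finite-dimensional complex representations of `G`. -/
def charDegrees (G : Type) [Group G] : Set ℕ :=
  { n | ∃ V : FDRep ℂ G, Simple V ∧ Module.finrank ℂ V = n }

/-- `ρ(G)`: the set of primes dividing some character degree of `G`. -/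
def charPrimes (G : Type) [Group G] : Set ℕ :=
  { p | p.Prime ∧ ∃ n ∈ charDegrees G, p ∣ n }

/-- The character graph `Δ(G)`, on vertex set `ρ(G)`: two distinct primes `p`, `q`
are adjacent iff `p * q` divides some character degree of `G`. -/
def charGraph (G : Type) [Group G] : SimpleGraph (charPrimes G) where
  Adj p q := (p : ℕ) ≠ (q : ℕ) ∧ ∃ n ∈ charDegrees G, (p : ℕ) * (q : ℕ) ∣ n
  symm := by
    refine ⟨?_⟩
    rintro p q ⟨h, n, hn, hd⟩
    exact ⟨fun e => h e.symm, n, hn, by rwa [mul_comm]⟩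
  loopless := by refine ⟨?_⟩; rintro p ⟨h, -⟩; exact h rfl

/-- The solvable radical `R(G)` of `G`: the largest solvable normal subgroup of `G`
(realized as the join of all solvable normal subgroups). -/
def solvableRadical (G : Type*) [Group G] : Subgroup G :=
  ⨆ N : { N : Subgroup G // N.Normal ∧ IsSolvable ↥N }, (N : Subgroup G)

instance solvableRadical_normal (G : Type*) [Group G] : (solvableRadical G).Normal := by
  constructor
  intro n hn g
  refine Subgroup.iSup_induction (C := fun x => g * x * g⁻¹ ∈ solvableRadical G)
    (fun N : { N : Subgroup G // N.Normal ∧ IsSolvable ↥N } => (N : Subgroup G)) hn ?_ ?_ ?_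
  · intro N x hx
    exact Subgroup.mem_iSup_of_mem N (N.2.1.conj_mem x hx g)
  · simpa using Subgroup.one_mem _
  · intro x y hx hy
    have h : g * (x * y) * g⁻¹ = (g * x * g⁻¹) * (g * y * g⁻¹) := by group
    rw [h]; exact Subgroup.mul_mem _ hx hy

/-- `PSL₂(F)`: the special linear group `SL₂(F)` modulo its center. -/
abbrev PSL2 (F : Type) [Field F] :=
  Matrix.SpecialLinearGroup (Fin 2) F ⧸
    Subgroup.center (Matrix.SpecialLinearGroup (Fin 2) F)

/-- The join `Γ ⋆ Δ` of two simple graphs: the disjoint union together with all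
edges between the two vertex sets. -/
def graphJoin {α β : Type*} (G : SimpleGraph α) (H : SimpleGraph β) :
    SimpleGraph (α ⊕ β) :=
  (G ⊕g H) ⊔
    { Adj := fun u v => u.isLeft ≠ v.isLeft
      symm := ⟨fun _ _ h => h.symm⟩
      loopless := ⟨fun _ h => h rfl⟩ }

/-- The image of a subgroup `M` of `G` in `G/R(G)`; when `R(G) ≤ M` this is `M/R(G)`. -/
def radicalQuotImage {G : Type*} [Group G] (M : Subgroup G) :
    Subgroup (G ⧸ solvableRadical G) :=
  M.map (QuotientGroup.mk' (solvableRadical G))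

/-- Irreducibility, unbundled. -/
def Irr {Γ V : Type} [Group Γ] [AddCommGroup V] [Module ℂ V] (ρ : Representation ℂ Γ V) : Prop :=
  Nontrivial V ∧ ∀ W : Submodule ℂ V, (∀ g, ∀ v ∈ W, ρ g v ∈ W) → W = ⊥ ∨ W = ⊤

theorem irr_mem_charDegrees {Γ V : Type} [Group Γ] [Finite Γ] [AddCommGroup V] [Module ℂ V]
    [FiniteDimensional ℂ V] (ρ : Representation ℂ Γ V) (h : Irr ρ) :
    Module.finrank ℂ V ∈ charDegrees Γ := by
  obtain ⟨hn, h⟩ := h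
  refine ⟨FDRep.of ρ, ?_, rfl⟩
  rw [FDRep.simple_iff_end_is_rank_one]
  have hone : (𝟙 (FDRep.of ρ)) ≠ 0 := by
    intro h0
    obtain ⟨v, hv⟩ := exists_ne (0 : V)
    apply hv
    have := congrArg (fun φ : FDRep.of ρ ⟶ FDRep.of ρ => φ.hom.hom.hom v) h0
    exact this
  rw [finrank_eq_one_iff_of_nonzero' _ hone]
  intro φ
  let A : V →ₗ[ℂ] V := φ.hom.hom.hom
  have hA : ∀ g v, A (ρ g v) = ρ g (A v) := by
    intro g v
    have := congrArg (fun ψ => ψ.hom.hom v) (φ.comm g)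
    exact this
  obtain ⟨c, hc⟩ := Module.End.exists_eigenvalue A
  have := h (Module.End.eigenspace A c) (by
    intro g v hv
    rw [Module.End.mem_eigenspace_iff] at hv ⊢
    rw [hA, hv, map_smul])
  refine ⟨c, ?_⟩
  rcases this with h1 | h1
  · exact absurd h1 hc
  · ext v
    have : v ∈ Module.End.eigenspace A c := h1 ▸ Submodule.mem_top
    rw [Module.End.mem_eigenspace_iff] at this
    exact this.symm

theorem charDegrees_irr {Γ : Type} [Group Γ] {n : ℕ} (h : n ∈ charDegrees Γ) :
    ∃ (V : Type) (_ : AddCommGroup V) (_ : Module ℂ V) (_ : FiniteDimensional ℂ V)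
      (ρ : Representation ℂ Γ V), Irr ρ ∧ Module.finrank ℂ V = n := by
  obtain ⟨V, hV, hn⟩ := h
  refine ⟨V, inferInstance, inferInstance, inferInstance, V.ρ, ⟨?_, ?_⟩, hn⟩
  · by_contra hnt
    rw [not_nontrivial_iff_subsingleton] at hnt
    apply id_nonzero V
    ext v
    exact Subsingleton.elim (α := V) _ _
  · intro W hW
    let σ : Representation ℂ Γ W := 
      { toFun := fun g => (V.ρ g).restrict (hW g)
        map_one' := by ext; simp
        map_mul' := fun x y => by ext; simp }
    let i : FDRep.of σ ⟶ V := ⟨InducedCategory.homMk (ModuleCat.ofHom W.subtype), fun g => by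
      ext1; ext1; rfl⟩
    have hi : ∀ x : W, i.hom.hom.hom x = (x : V) := fun x => rfl
    have hm : Mono i := by
      constructor
      intro Z a b hab
      ext z
      have := congrArg (fun ψ => ψ.hom.hom.hom z) hab
      exact this
    by_cases h0 : i = 0
    · left
      rw [eq_bot_iff]
      intro x hx
      have := congrArg (fun ψ : FDRep.of σ ⟶ V => ψ.hom.hom.hom (⟨x, hx⟩ : W)) h0
      exact this
    · right
      have hiso := isIso_of_mono_of_nonzero h0
      rw [eq_top_iff]
      intro x _
      have := congrArg (fun ψ : V ⟶ V => ψ.hom.hom.hom x) (IsIso.inv_hom_id i)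
      change i.hom.hom.hom ((inv i).hom.hom.hom x) = x at this
      rw [← this]
      exact ((inv i).hom.hom.hom x : W).2

/-- Common eigenvector for commuting operators. -/
theorem common_eigvec {V ι : Type} [AddCommGroup V] [Module ℂ V] [FiniteDimensional ℂ V]
    (A : ι → V →ₗ[ℂ] V) (W : Submodule ℂ V) (hW : W ≠ ⊥)
    (hinv : ∀ i, ∀ v ∈ W, A i v ∈ W)
    (hcomm : ∀ i j, ∀ v ∈ W, A i (A j v) = A j (A i v)) :
    ∃ v ∈ W, v ≠ 0 ∧ ∀ i, ∃ c : ℂ, A i v = c • v := by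
  induction hn : Module.finrank ℂ W using Nat.strong_induction_on generalizing W with
  | _ n ih =>
  by_cases hs : ∀ i, ∃ c : ℂ, ∀ v ∈ W, A i v = c • v
  · obtain ⟨v, hv, hv0⟩ := Submodule.exists_mem_ne_zero_of_ne_bot hW
    exact ⟨v, hv, hv0, fun i => (hs i).imp fun c hc => hc v hv⟩
  · push Not at hs
    obtain ⟨i, hi⟩ := hs
    have : Nontrivial W := Submodule.nontrivial_iff_ne_bot.2 hW
    obtain ⟨c, hc⟩ := Module.End.exists_eigenvalue ((A i).restrict (hinv i))
    obtain ⟨w, hw⟩ := hc.exists_hasEigenvector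
    let W' : Submodule ℂ V := W ⊓ Module.End.eigenspace (A i) c
    have hmem : ∀ v, v ∈ W' ↔ v ∈ W ∧ A i v = c • v := by
      intro v; simp [W', Module.End.mem_eigenspace_iff]
    have hw1 : (w : V) ∈ W' := by
      rw [hmem]
      refine ⟨w.2, ?_⟩
      have := congrArg Subtype.val hw.apply_eq_smul
      simpa using this
    obtain ⟨v0, hv0, hv0'⟩ := hi c
    have hlt : W' < W := by
      refine lt_of_le_of_ne inf_le_left ?_
      intro he
      exact hv0' ((hmem v0).1 (he ▸ hv0)).2
    obtain ⟨v, hv, h2⟩ := ih _ (hn ▸ Submodule.finrank_lt_finrank_of_lt hlt) W'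
      (fun hb => hw.2 (by
        have : (w : V) ∈ (⊥ : Submodule ℂ V) := hb ▸ hw1
        exact Subtype.ext (by simpa using this)))
      (fun j v hv => by
        rw [hmem] at hv ⊢
        exact ⟨hinv j v hv.1, by rw [hcomm i j v hv.1, hv.2, map_smul]⟩)
      (fun j k v hv => hcomm j k v ((hmem v).1 hv).1) rfl
    exact ⟨v, ((hmem v).1 hv).1, h2⟩

/-- Existence of irreducibles over a representation of a subgroup. -/
theorem exists_irr_over {Γ W : Type} [Group Γ] [Finite Γ] (K : Subgroup Γ)
    [AddCommGroup W] [Module ℂ W] [FiniteDimensional ℂ W] [Nontrivial W]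
    (σ : Representation ℂ K W) :
    ∃ (V : Type) (_ : AddCommGroup V) (_ : Module ℂ V) (_ : FiniteDimensional ℂ V)
      (ρ : Representation ℂ Γ V), Irr ρ ∧ ∃ j : W →ₗ[ℂ] V, j ≠ 0 ∧
        ∀ (k : K) (w : W), j (σ k w) = ρ (k : Γ) (j w) := by
  classical
  let τ : Representation ℂ Γ (Γ → W) :=
    { toFun := fun g => LinearMap.funLeft ℂ W (fun x => x * g)
      map_one' := by ext; simp [LinearMap.funLeft]
      map_mul' := fun x y => by ext; simp [LinearMap.funLeft, mul_assoc] }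
  have hτ : ∀ g f x, τ g f x = f (x * g) := fun g f x => rfl
  let j0 : W →ₗ[ℂ] (Γ → W) := LinearMap.pi fun x =>
    if h : x ∈ K then σ ⟨x, h⟩ else 0
  have hj0 : ∀ (k : K) (w : W), j0 (σ k w) = τ (k : Γ) (j0 w) := by
    intro k w
    funext x
    rw [hτ]
    simp only [j0, LinearMap.pi_apply]
    by_cases h : x ∈ K
    · have h' : x * k ∈ K := K.mul_mem h k.2
      rw [dif_pos h, dif_pos h']
      have : (⟨x * k, h'⟩ : K) = ⟨x, h⟩ * k := rfl
      rw [this, map_mul]; rfl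
    · have h' : ¬ x * k ∈ K := fun h2 => h ((K.mul_mem_cancel_right k.2).1 h2)
      rw [dif_neg h, dif_neg h']; rfl
  have hj1 : ∀ w, j0 w 1 = w := by
    intro w
    simp only [j0, LinearMap.pi_apply]
    rw [dif_pos K.one_mem]
    have : (⟨1, K.one_mem⟩ : K) = 1 := rfl
    rw [this, map_one]; rfl
  -- invariant submodules
  let M : Submodule ℂ (Γ → W) := ⨆ g, (LinearMap.range j0).map (τ g)
  have hMinv : ∀ g, ∀ v ∈ M, τ g v ∈ M := by
    intro g
    change M ≤ M.comap (τ g)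
    refine iSup_le fun h => ?_
    rintro _ ⟨x, hx, rfl⟩
    refine Submodule.mem_iSup_of_mem (g * h) ⟨x, hx, ?_⟩
    rw [map_mul]; rfl
  have hjM : ∀ w, j0 w ∈ M := fun w =>
    Submodule.mem_iSup_of_mem 1 ⟨_, ⟨w, rfl⟩, by rw [map_one]; rfl⟩
  have hMmin : ∀ X : Submodule ℂ (Γ → W), (∀ g, ∀ v ∈ X, τ g v ∈ X) → (∀ w, j0 w ∈ X) →
      M ≤ X := by
    intro X hX hjX
    refine iSup_le fun h => ?_
    rintro _ ⟨_, ⟨w, rfl⟩, rfl⟩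
    exact hX _ _ (hjX w)
  let P : Submodule ℂ (Γ → W) → Prop := fun X => (∀ g, ∀ v ∈ X, τ g v ∈ X) ∧ X < M
  have hP0 : P ⊥ := by
    refine ⟨fun g v hv => by simp only [Submodule.mem_bot] at hv ⊢; rw [hv, map_zero], ?_⟩
    rw [bot_lt_iff_ne_bot]
    intro h
    obtain ⟨w, hw⟩ := exists_ne (0 : W)
    have h1 := hjM w
    rw [h, Submodule.mem_bot] at h1
    apply hw
    rw [← hj1 w, h1]; rfl
  obtain ⟨X, hX, hXmax⟩ : ∃ X, P X ∧ ∀ Y, P Y → ¬ X < Y := by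
    have := (inferInstance : WellFoundedGT (Submodule ℂ (Γ → W))).wf.has_min {X | P X} ⟨⊥, hP0⟩
    obtain ⟨X, hX, h⟩ := this
    exact ⟨X, hX, h⟩
  let X' : Submodule ℂ M := X.comap M.subtype
  let τM : Representation ℂ Γ M :=
    { toFun := fun g => (τ g).restrict (hMinv g)
      map_one' := by ext; simp
      map_mul' := fun x y => by ext; simp }
  have hX' : ∀ g, X' ≤ X'.comap (τM g) := fun g v hv => hX.1 g _ hv
  let ρ : Representation ℂ Γ (M ⧸ X') :=
    { toFun := fun g => X'.mapQ X' (τM g) (hX' g)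
      map_one' := by ext; simp
      map_mul' := fun x y => by ext; simp }
  have hρ : ∀ g x, ρ g (X'.mkQ x) = X'.mkQ (τM g x) := fun g x => rfl
  let j : W →ₗ[ℂ] (M ⧸ X') := X'.mkQ ∘ₗ j0.codRestrict M hjM
  have hj : j ≠ 0 := by
    intro h0
    have : M ≤ X := hMmin X hX.1 (fun w => by
      have h1 : X'.mkQ (j0.codRestrict M hjM w) = 0 := congrArg (fun f => f w) h0
      rw [Submodule.mkQ_apply, Submodule.Quotient.mk_eq_zero] at h1
      exact h1)
    exact absurd hX.2 (not_lt_of_ge this)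
  refine ⟨M ⧸ X', inferInstance, inferInstance, inferInstance, ρ, ⟨?_, ?_⟩, j, hj, ?_⟩
  · by_contra hnt
    rw [not_nontrivial_iff_subsingleton] at hnt
    exact hj (LinearMap.ext fun w => Subsingleton.elim _ _)
  · intro Y hY
    let Z : Submodule ℂ (Γ → W) := (Y.comap X'.mkQ).map M.subtype
    have hZinv : ∀ g, ∀ v ∈ Z, τ g v ∈ Z := by
      rintro g _ ⟨v, hv, rfl⟩
      refine ⟨τM g v, ?_, rfl⟩
      change X'.mkQ (τM g v) ∈ Y
      rw [← hρ]; exact hY g _ hv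
    have hZM : Z ≤ M := by rintro _ ⟨v, hv, rfl⟩; exact v.2
    have hXZ : X ≤ Z := by
      intro x hx
      refine ⟨⟨x, hX.2.le hx⟩, ?_, rfl⟩
      change X'.mkQ _ ∈ Y
      have : X'.mkQ ⟨x, hX.2.le hx⟩ = 0 := by
        rw [Submodule.mkQ_apply, Submodule.Quotient.mk_eq_zero]; exact hx
      rw [this]; exact Y.zero_mem
    by_cases hZ : Z = M
    · right
      rw [eq_top_iff]
      intro y _
      obtain ⟨v, rfl⟩ := X'.mkQ_surjective y
      have : (v : Γ → W) ∈ Z := by rw [hZ]; exact v.2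
      obtain ⟨v', hv', he⟩ := this
      have : v' = v := Subtype.ext he
      exact this ▸ hv'
    · left
      have hZX : Z = X := by
        by_contra hne
        exact hXmax Z ⟨hZinv, lt_of_le_of_ne hZM hZ⟩ (lt_of_le_of_ne hXZ (Ne.symm hne))
      rw [eq_bot_iff]
      intro y hy
      obtain ⟨v, rfl⟩ := X'.mkQ_surjective y
      have : (v : Γ → W) ∈ Z := ⟨v, hy, rfl⟩
      rw [hZX] at this
      rw [Submodule.mem_bot, Submodule.mkQ_apply, Submodule.Quotient.mk_eq_zero]; exact this
  · intro k w
    change X'.mkQ _ = ρ _ (X'.mkQ _)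
    rw [hρ]
    congr 1
    exact Subtype.ext (hj0 k w)

/-- Existence of irreducibles over a linear character of a subgroup. -/
theorem exists_irr_char {Γ : Type} [Group Γ] [Finite Γ] (K : Subgroup Γ) (χ : K →* ℂˣ) :
    ∃ (V : Type) (_ : AddCommGroup V) (_ : Module ℂ V) (_ : FiniteDimensional ℂ V)
      (ρ : Representation ℂ Γ V), Irr ρ ∧ ∃ v : V, v ≠ 0 ∧
        ∀ k : K, ρ (k : Γ) v = (χ k : ℂ) • v := by
  let σ : Representation ℂ K ℂ :=
    { toFun := fun k => (χ k : ℂ) • LinearMap.id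
      map_one' := by ext; simp
      map_mul' := fun x y => by ext; simp [mul_comm] }
  obtain ⟨V, i1, i2, i3, ρ, hρ, j, hj, hjk⟩ := exists_irr_over K σ
  refine ⟨V, i1, i2, i3, ρ, hρ, j 1, ?_, ?_⟩
  · intro h
    apply hj
    ext
    simpa using h
  · intro k
    rw [← hjk]
    have : σ k 1 = (χ k : ℂ) • (1 : ℂ) := rfl
    rw [this, map_smul]

/-- An irreducible representation is spanned by any orbit of a nonzero subspace. -/
theorem Irr.eq_top_of {Γ V : Type} [Group Γ] [AddCommGroup V] [Module ℂ V]
    {ρ : Representation ℂ Γ V} (h : Irr ρ) (X : Submodule ℂ V) (hX : ∀ g, ∀ v ∈ X, ρ g v ∈ X)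
    {v : V} (hv : v ∈ X) (hv0 : v ≠ 0) : X = ⊤ := by
  rcases h.2 X hX with h | h
  · rw [h] at hv; exact absurd hv hv0
  · exact h

/-- Clifford: degrees of a normal subgroup divide degrees of the group. -/
theorem clifford_dvd {Γ : Type} [Group Γ] [Finite Γ] (K : Subgroup Γ) [hK : K.Normal] {d : ℕ}
    (hd : d ∈ charDegrees K) : ∃ n ∈ charDegrees Γ, d ∣ n := by
  classical
  obtain ⟨W, i1, i2, i3, σ, hσ, hWd⟩ := charDegrees_irr hd
  have := hσ.1
  obtain ⟨V, i4, i5, i6, ρ, hρ, j, hj, hjk⟩ := exists_irr_over K σ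
  refine ⟨_, irr_mem_charDegrees ρ hρ, ?_⟩
  have hker : LinearMap.ker j = ⊥ := by
    rcases hσ.2 (LinearMap.ker j) (fun g v hv => by
      rw [LinearMap.mem_ker] at hv ⊢
      rw [hjk, hv, map_zero]) with h | h
    · exact h
    · exact absurd (LinearMap.ker_eq_top.1 h) hj
  have hinj : Function.Injective j := LinearMap.ker_eq_bot.1 hker
  -- K-simple subspaces of dim d
  let Y : Γ → Submodule ℂ V := fun g => (LinearMap.range j).map (ρ g)
  have hρinj : ∀ g, Function.Injective (ρ g) := by
    intro g x y hxy
    have := congrArg (ρ g⁻¹) hxy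
    simpa [← Module.End.mul_apply, ← map_mul] using this
  have hYd : ∀ g, Module.finrank ℂ (Y g) = d := by
    intro g
    rw [← hWd, ← LinearMap.finrank_range_of_inj hinj]
    exact (LinearEquiv.finrank_eq (Submodule.equivMapOfInjective (ρ g) (hρinj g) _)).symm
  have hYsimple : ∀ g (X : Submodule ℂ V), (∀ k ∈ K, ∀ v ∈ X, ρ k v ∈ X) →
      Y g ≤ X ∨ Disjoint X (Y g) := by
    intro g X hX
    rcases hσ.2 (X.comap (ρ g ∘ₗ j)) (fun k w hw => by
      simp only [Submodule.mem_comap, LinearMap.comp_apply] at hw ⊢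
      rw [hjk]
      have h2 := hX (g * k * g⁻¹) (hK.conj_mem _ k.2 g) _ hw
      rw [← Module.End.mul_apply, ← map_mul] at h2 ⊢
      simpa using h2) with h | h
    · right
      rw [Submodule.disjoint_def]
      rintro _ hx ⟨_, ⟨w, rfl⟩, rfl⟩
      have : w ∈ (⊥ : Submodule ℂ W) := by rw [← h]; exact hx
      rw [Submodule.mem_bot] at this
      rw [this, map_zero, map_zero]
    · left
      rintro _ ⟨_, ⟨w, rfl⟩, rfl⟩
      have : w ∈ (⊤ : Submodule ℂ W) := Submodule.mem_top
      rw [← h] at this; exact this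
  have hYinv : ∀ g, ∀ k ∈ K, ∀ v ∈ Y g, ρ k v ∈ Y g := by
    rintro g k hk _ ⟨_, ⟨w, rfl⟩, rfl⟩
    refine ⟨_, ⟨σ ⟨g⁻¹ * k * g, by simpa using hK.conj_mem k hk g⁻¹⟩ w, rfl⟩, ?_⟩
    rw [hjk, ← Module.End.mul_apply, ← map_mul, ← Module.End.mul_apply, ← map_mul]
    congr 2
    group
  have hfin : ∀ s : Finset Γ, (∀ k ∈ K, ∀ v ∈ s.sup Y, ρ k v ∈ s.sup Y) ∧
      d ∣ Module.finrank ℂ (s.sup Y : Submodule ℂ V) := by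
    intro s
    induction s using Finset.induction_on with
    | empty =>
      refine ⟨by simp, ?_⟩
      rw [Finset.sup_empty, finrank_bot]; exact dvd_zero _
    | insert g s hg ih =>
      rw [Finset.sup_insert]
      constructor
      · intro k hk v hv
        obtain ⟨a, ha, b, hb, rfl⟩ := Submodule.mem_sup.1 hv
        rw [map_add]
        exact Submodule.add_mem_sup (hYinv g k hk a ha) (ih.1 k hk b hb)
      · rcases hYsimple g _ ih.1 with h | h
        · rw [sup_eq_right.2 h]; exact ih.2
        · have h3 := Submodule.finrank_sup_add_finrank_inf_eq (Y g) (s.sup Y)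
          rw [inf_comm, h.eq_bot, finrank_bot, add_zero, hYd] at h3
          rw [h3]
          exact dvd_add dvd_rfl ih.2
  have := Fintype.ofFinite Γ
  have htop : (Finset.univ.sup Y : Submodule ℂ V) = ⊤ := by
    obtain ⟨w, hw⟩ : ∃ w, j w ≠ 0 := by
      by_contra hcon
      push Not at hcon
      exact hj (LinearMap.ext hcon)
    refine hρ.eq_top_of _ ?_ (v := j w) ?_ hw
    · intro g
      change _ ≤ Submodule.comap (ρ g) _
      refine Finset.sup_le fun h _ => ?_
      rintro _ ⟨x, hx, rfl⟩
      refine (Finset.le_sup (f := Y) (Finset.mem_univ (g * h))) ⟨x, hx, ?_⟩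
      rw [map_mul]; rfl
    · refine (Finset.le_sup (f := Y) (Finset.mem_univ 1)) ⟨j w, ⟨w, rfl⟩, ?_⟩
      rw [map_one]; rfl
  have h5 := (hfin Finset.univ).2
  rwa [htop, finrank_top] at h5

theorem charDegrees_equiv {Γ Γ' : Type} [Group Γ] [Group Γ'] [Finite Γ'] (e : Γ' ≃* Γ) {d : ℕ}
    (hd : d ∈ charDegrees Γ) : d ∈ charDegrees Γ' := by
  obtain ⟨W, i1, i2, i3, σ, hσ, rfl⟩ := charDegrees_irr hd
  refine irr_mem_charDegrees (σ.comp e.toMonoidHom) ⟨hσ.1, fun W hW => hσ.2 W fun g v hv => ?_⟩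
  have := hW (e.symm g) v hv
  simpa using this

theorem charDegrees_surj {Γ Γ' : Type} [Group Γ] [Group Γ'] [Finite Γ'] (e : Γ' →* Γ)
    (he : Function.Surjective e) {d : ℕ}
    (hd : d ∈ charDegrees Γ) : d ∈ charDegrees Γ' := by
  obtain ⟨W, i1, i2, i3, σ, hσ, rfl⟩ := charDegrees_irr hd
  refine irr_mem_charDegrees (σ.comp e) ⟨hσ.1, fun W hW => hσ.2 W fun g v hv => ?_⟩
  obtain ⟨g, rfl⟩ := he g
  exact hW g v hv

/-- Simultaneous eigenvectors with distinct weights are independent. -/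
theorem weights_indep {ι κ V : Type} [AddCommGroup V] [Module ℂ V]
    (A : κ → V →ₗ[ℂ] V) (χ : ι → κ → ℂ) (hχ : ∀ i j, i ≠ j → ∃ k, χ i k ≠ χ j k)
    (s : Finset ι) (w : ι → V) (hw : ∀ i k, A k (w i) = χ i k • w i)
    (hsum : ∑ i ∈ s, w i = 0) : ∀ i ∈ s, w i = 0 := by
  classical
  induction s using Finset.induction_on generalizing w with
  | empty => simp
  | insert i0 s hi0 ih =>
    rw [Finset.sum_insert hi0] at hsum
    have hs : ∀ j ∈ s, w j = 0 := by
      intro j hj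
      obtain ⟨k, hk⟩ := hχ i0 j (fun h => hi0 (h ▸ hj))
      have := ih (fun i => (χ i k - χ i0 k) • w i) (fun i k' => by
          rw [map_smul, hw, smul_comm]) (by
        have h1 := congrArg (A k) hsum
        rw [map_add, map_sum, map_zero, hw] at h1
        simp only [hw] at h1
        have h2 : χ i0 k • (w i0 + ∑ i ∈ s, w i) = 0 := by rw [hsum, smul_zero]
        rw [smul_add, Finset.smul_sum] at h2
        simp only [sub_smul, Finset.sum_sub_distrib]
        rw [sub_eq_zero]
        exact add_left_cancel (h1.trans h2.symm)) j hj
      rcases smul_eq_zero.1 this with h | h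
      · exact absurd (sub_eq_zero.1 h).symm hk
      · exact h
    intro i hi
    rcases Finset.mem_insert.1 hi with rfl | hi
    · rwa [Finset.sum_eq_zero hs, add_zero] at hsum
    · exact hs i hi

/-- Imprimitivity: dimension of the span of translates of a weight space. -/
theorem imprimitive {Γ V : Type} [Group Γ] [Finite Γ] [AddCommGroup V] [Module ℂ V]
    [FiniteDimensional ℂ V] (ρ : Representation ℂ Γ V) (Δ T A : Subgroup Γ)
    (χ : Γ → ℂ) (hTΔ : T ≤ Δ) (hA : ∀ g ∈ Δ, ∀ a ∈ A, g⁻¹ * a * g ∈ A)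
    (hT : ∀ g ∈ Δ, (∀ a ∈ A, χ (g⁻¹ * a * g) = χ a) → g ∈ T)
    (W : Submodule ℂ V) (hW : ∀ a ∈ A, ∀ w ∈ W, ρ a w = χ a • w)
    (hTW : ∀ t ∈ T, ∀ w ∈ W, ρ t w ∈ W) :
    ∃ X : Submodule ℂ V, W ≤ X ∧ (∀ g ∈ Δ, ∀ v ∈ X, ρ g v ∈ X) ∧
      Module.finrank ℂ X = T.relIndex Δ * Module.finrank ℂ W ∧
      ∀ Y : Submodule ℂ V, W ≤ Y → (∀ g ∈ Δ, ∀ v ∈ Y, ρ g v ∈ Y) → X ≤ Y := by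
  classical
  let ι := ↥Δ ⧸ T.subgroupOf Δ
  have : Fintype ι := Fintype.ofFinite ι
  let γ : ι → Γ := fun i => ((Quotient.out i : Δ) : Γ)
  have hγΔ : ∀ i, γ i ∈ Δ := fun i => (Quotient.out i : Δ).2
  have hγ : ∀ i j, (γ i)⁻¹ * γ j ∈ T → i = j := by
    intro i j h
    rw [← Quotient.out_eq i, ← Quotient.out_eq j]
    exact QuotientGroup.eq.2 h
  have hγ2 : ∀ g ∈ Δ, ∃ i, (γ i)⁻¹ * g ∈ T := by
    intro g hg
    refine ⟨((⟨g, hg⟩ : Δ) : ι), ?_⟩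
    have : ((Quotient.out ((⟨g, hg⟩ : Δ) : ι) : Δ) : ι) = ((⟨g, hg⟩ : Δ) : ι) := Quotient.out_eq _
    have h2 := (QuotientGroup.eq (s := T.subgroupOf Δ)).1 this
    exact h2
  let Φ : (ι → W) →ₗ[ℂ] V := ∑ i, ρ (γ i) ∘ₗ W.subtype ∘ₗ LinearMap.proj i
  have hΦ : ∀ f, Φ f = ∑ i, ρ (γ i) (f i : V) := by
    intro f; simp [Φ, LinearMap.sum_apply]
  have hΦinj : Function.Injective Φ := by
    rw [← LinearMap.ker_eq_bot, eq_bot_iff]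
    intro f hf
    rw [LinearMap.mem_ker, hΦ] at hf
    have := weights_indep (ι := ι) (κ := A) (fun a => ρ (a : Γ))
      (fun i a => χ ((γ i)⁻¹ * a * γ i)) (by
        intro i j hij
        by_contra hcon
        push Not at hcon
        apply hij
        apply hγ
        apply hT _ (Δ.mul_mem (Δ.inv_mem (hγΔ i)) (hγΔ j))
        intro a ha
        have h1 := hcon ⟨γ i * a * (γ i)⁻¹, by
          simpa using hA _ (Δ.inv_mem (hγΔ i)) a ha⟩
        simp only at h1
        calc χ (((γ i)⁻¹ * γ j)⁻¹ * a * ((γ i)⁻¹ * γ j))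
            = χ ((γ j)⁻¹ * (γ i * a * (γ i)⁻¹) * γ j) := by congr 1; group
          _ = χ ((γ i)⁻¹ * (γ i * a * (γ i)⁻¹) * γ i) := h1.symm
          _ = χ a := by congr 1; group)
      Finset.univ (fun i => ρ (γ i) (f i : V)) (by
        intro i a
        change ρ (a : Γ) (ρ (γ i) (f i : V)) = _
        have h1 := hW _ (hA _ (hγΔ i) a a.2) (f i) (f i).2
        rw [← map_smul, ← h1, ← Module.End.mul_apply, ← map_mul, ← Module.End.mul_apply, ← map_mul]
        congr 2
        group) hf
    rw [Submodule.mem_bot]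
    funext i
    have h2 := congrArg (ρ (γ i)⁻¹) (this i (Finset.mem_univ _))
    apply Subtype.ext
    simpa [← Module.End.mul_apply, ← map_mul] using h2
  have hcoset : ∀ g ∈ Δ, ∀ w ∈ W, ρ g w ∈ LinearMap.range Φ := by
    intro g hg w hw
    obtain ⟨i, hi⟩ := hγ2 g hg
    refine ⟨Pi.single i ⟨ρ ((γ i)⁻¹ * g) w, hTW _ hi w hw⟩, ?_⟩
    rw [hΦ, Finset.sum_eq_single i]
    · rw [Pi.single_eq_same]
      rw [← Module.End.mul_apply, ← map_mul]
      congr 2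
      group
    · intro j _ hj
      rw [Pi.single_eq_of_ne hj]; simp
    · simp
  refine ⟨LinearMap.range Φ, ?_, ?_, ?_, ?_⟩
  · intro w hw
    have := hcoset 1 Δ.one_mem w hw
    simpa using this
  · rintro g hg _ ⟨f, rfl⟩
    rw [hΦ, map_sum]
    refine Submodule.sum_mem _ fun i _ => ?_
    rw [← Module.End.mul_apply, ← map_mul]
    exact hcoset _ (Δ.mul_mem hg (hγΔ i)) _ (f i).2
  · rw [LinearMap.finrank_range_of_inj hΦinj, Module.finrank_pi_fintype, Finset.sum_const,
      Finset.card_univ, smul_eq_mul, Subgroup.relIndex, Subgroup.index, Nat.card_eq_fintype_card]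
  · rintro Y hWY hY _ ⟨f, rfl⟩
    rw [hΦ]
    exact Submodule.sum_mem _ fun i _ => hY _ (hγΔ i) _ (hWY (f i).2)

namespace KT
open Matrix
open scoped commutatorElement

abbrev SL (F : Type) [Field F] := Matrix.SpecialLinearGroup (Fin 2) F

section basic
variable {F : Type} [Field F]

theorem ext4 {g h : SL F} (h1 : g 0 0 = h 0 0) (h2 : g 0 1 = h 0 1) (h3 : g 1 0 = h 1 0)
    (h4 : g 1 1 = h 1 1) : g = h := by
  ext i j
  fin_cases i <;> fin_cases j <;> assumption

theorem mul00 (g h : SL F) : (g * h) 0 0 = g 0 0 * h 0 0 + g 0 1 * h 1 0 := by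
  simp [Matrix.mul_apply, Fin.sum_univ_two]
theorem mul01 (g h : SL F) : (g * h) 0 1 = g 0 0 * h 0 1 + g 0 1 * h 1 1 := by
  simp [Matrix.mul_apply, Fin.sum_univ_two]
theorem mul10 (g h : SL F) : (g * h) 1 0 = g 1 0 * h 0 0 + g 1 1 * h 1 0 := by
  simp [Matrix.mul_apply, Fin.sum_univ_two]
theorem mul11 (g h : SL F) : (g * h) 1 1 = g 1 0 * h 0 1 + g 1 1 * h 1 1 := by
  simp [Matrix.mul_apply, Fin.sum_univ_two]
theorem one00 : (1 : SL F) 0 0 = 1 := by simp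
theorem one01 : (1 : SL F) 0 1 = 0 := by simp
theorem one10 : (1 : SL F) 1 0 = 0 := by simp
theorem one11 : (1 : SL F) 1 1 = 1 := by simp
theorem inv00 (g : SL F) : g⁻¹ 0 0 = g 1 1 := by
  rw [SpecialLinearGroup.SL2_inv_expl]; rfl
theorem inv01 (g : SL F) : g⁻¹ 0 1 = - g 0 1 := by
  rw [SpecialLinearGroup.SL2_inv_expl]; rfl
theorem inv10 (g : SL F) : g⁻¹ 1 0 = - g 1 0 := by
  rw [SpecialLinearGroup.SL2_inv_expl]; rfl
theorem inv11 (g : SL F) : g⁻¹ 1 1 = g 0 0 := by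
  rw [SpecialLinearGroup.SL2_inv_expl]; rfl
theorem det4 (g : SL F) : g 0 0 * g 1 1 - g 0 1 * g 1 0 = 1 := by
  rw [← Matrix.det_fin_two]; exact g.2

/-- general matrix -/
def mk (a b c d : F) (h : a * d - b * c = 1) : SL F :=
  ⟨!![a, b; c, d], by rwa [det_fin_two_of]⟩

@[simp] theorem mk00 (a b c d : F) (h) : mk a b c d h 0 0 = a := rfl
@[simp] theorem mk01 (a b c d : F) (h) : mk a b c d h 0 1 = b := rfl
@[simp] theorem mk10 (a b c d : F) (h) : mk a b c d h 1 0 = c := rfl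
@[simp] theorem mk11 (a b c d : F) (h) : mk a b c d h 1 1 = d := rfl

def u (b : F) : SL F := mk 1 b 0 1 (by ring)
def t (a : Fˣ) : SL F := mk a 0 0 (a⁻¹ : Fˣ) (by simp)
/-- antidiagonal -/
def m (c : Fˣ) : SL F := mk 0 (-(c⁻¹ : Fˣ)) c 0 (by simp)

@[simp] theorem u00 (b : F) : u b 0 0 = 1 := rfl
@[simp] theorem u01 (b : F) : u b 0 1 = b := rfl
@[simp] theorem u10 (b : F) : u b 1 0 = 0 := rfl
@[simp] theorem u11 (b : F) : u b 1 1 = 1 := rfl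
@[simp] theorem t00 (a : Fˣ) : t a 0 0 = a := rfl
@[simp] theorem t01 (a : Fˣ) : t a 0 1 = 0 := rfl
@[simp] theorem t10 (a : Fˣ) : t a 1 0 = 0 := rfl
@[simp] theorem t11 (a : Fˣ) : t a 1 1 = (a : F)⁻¹ := by simp [t]
@[simp] theorem m00 (a : Fˣ) : m a 0 0 = 0 := rfl
@[simp] theorem m01 (a : Fˣ) : m a 0 1 = -(a : F)⁻¹ := by simp [m]
@[simp] theorem m10 (a : Fˣ) : m a 1 0 = a := rfl
@[simp] theorem m11 (a : Fˣ) : m a 1 1 = 0 := rfl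

theorem u_add (a b : F) : u (a + b) = u a * u b := by
  apply ext4 <;> simp only [mul00, mul01, mul10, mul11, u00, u01, u10, u11] <;> ring
theorem u_zero : u (0 : F) = 1 := by
  apply ext4 <;> simp
theorem u_inv (b : F) : (u b)⁻¹ = u (-b) := by
  rw [inv_eq_iff_mul_eq_one, ← u_add]; simp [u_zero]
theorem u_inj {a b : F} (h : u a = u b) : a = b := by
  have := congrArg (fun g : SL F => g 0 1) h
  simpa using this
theorem t_mul (a b : Fˣ) : t (a * b) = t a * t b := by
  apply ext4 <;> simp only [mul00, mul01, mul10, mul11, t00, t01, t10, t11] <;> simp [mul_comm]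
theorem t_one : t (1 : Fˣ) = 1 := by
  apply ext4 <;> simp
theorem t_inv (b : Fˣ) : (t b)⁻¹ = t (b⁻¹) := by
  rw [inv_eq_iff_mul_eq_one, ← t_mul]; simp [t_one]
theorem t_inj {a b : Fˣ} (h : t a = t b) : a = b := by
  have := congrArg (fun g : SL F => g 0 0) h
  simpa [Units.ext_iff] using this
theorem t_conj_u (a : Fˣ) (b : F) : t a * u b * (t a)⁻¹ = u (a ^ 2 * b) := by
  rw [t_inv]
  apply ext4 <;> simp only [mul00, mul01, mul10, mul11, u00, u01, u10, u11, t00, t01, t10, t11] <;>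
    simp <;> ring

/-- unipotent subgroup -/
def U (F : Type) [Field F] : Subgroup (SL F) where
  carrier := Set.range u
  mul_mem' := by rintro _ _ ⟨a, rfl⟩ ⟨b, rfl⟩; exact ⟨a + b, u_add a b⟩
  one_mem' := ⟨0, u_zero⟩
  inv_mem' := by rintro _ ⟨a, rfl⟩; exact ⟨-a, (u_inv a).symm⟩

/-- Borel subgroup -/
def B (F : Type) [Field F] : Subgroup (SL F) where
  carrier := {g | g 1 0 = 0}
  mul_mem' := by
    intro a b ha hb
    simp only [Set.mem_setOf_eq] at *
    rw [mul10, ha, hb]; simp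
  one_mem' := one10
  inv_mem' := by
    intro a ha
    simp only [Set.mem_setOf_eq] at *
    rw [inv10, ha, neg_zero]

theorem mem_U {g : SL F} : g ∈ U F ↔ ∃ b, u b = g := Iff.rfl
theorem mem_B {g : SL F} : g ∈ B F ↔ g 1 0 = 0 := Iff.rfl
theorem u_mem (b : F) : u b ∈ U F := ⟨b, rfl⟩
theorem t_mem_B (a : Fˣ) : t a ∈ B F := t10 a
theorem u_mem_B (a : F) : u a ∈ B F := u10 a
theorem U_le_B : U F ≤ B F := by rintro _ ⟨b, rfl⟩; exact u_mem_B b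

theorem B_decomp {g : SL F} (hg : g ∈ B F) : ∃ (a : Fˣ) (b : F), g = t a * u b := by
  rw [mem_B] at hg
  have hd := det4 g
  rw [hg, mul_zero, sub_zero] at hd
  have ha : g 0 0 ≠ 0 := left_ne_zero_of_mul_eq_one hd
  refine ⟨Units.mk0 _ ha, (g 0 0)⁻¹ * g 0 1, ?_⟩
  apply ext4 <;> simp only [mul00, mul01, mul10, mul11, u00, u01, u10, u11, t00, t01, t10, t11] <;>
    simp [hg, ha]
  exact eq_inv_of_mul_eq_one_right hd

theorem bruhat {g : SL F} (hg : g ∉ B F) : ∃ (s : F) (c : Fˣ) (r : F), g = u s * m c * u r := by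
  rw [mem_B] at hg
  have hd := det4 g
  refine ⟨g 0 0 * (g 1 0)⁻¹, Units.mk0 _ hg, (g 1 0)⁻¹ * g 1 1, ?_⟩
  apply ext4 <;> simp only [mul00, mul01, mul10, mul11, u00, u01, u10, u11, m00, m01, m10, m11] <;>
    simp [hg]
  field_simp
  linear_combination -hd

theorem u_m_u_10 (s : F) (c : Fˣ) (r : F) : (u s * m c * u r) 1 0 = c := by
  simp only [mul00, mul01, mul10, mul11, u00, u01, u10, u11, m00, m01, m10, m11]; simp
theorem u_m_u_00 (s : F) (c : Fˣ) (r : F) : (u s * m c * u r) 0 0 = s * c := by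
  simp only [mul00, mul01, mul10, mul11, u00, u01, u10, u11, m00, m01, m10, m11]; simp
theorem u_m_u_11 (s : F) (c : Fˣ) (r : F) : (u s * m c * u r) 1 1 = c * r := by
  simp only [mul00, mul01, mul10, mul11, u00, u01, u10, u11, m00, m01, m10, m11]; simp

/-- conjugating by B preserves U -/
theorem B_conj_U {g x : SL F} (hg : g ∈ B F) (hx : x ∈ U F) : g * x * g⁻¹ ∈ U F := by
  obtain ⟨a, b, rfl⟩ := B_decomp hg
  obtain ⟨c, rfl⟩ := hx
  refine ⟨a ^ 2 * c, ?_⟩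
  rw [← t_conj_u]
  have : u b * u c * (u b)⁻¹ = u c := by rw [← u_add, add_comm, u_add]; group
  calc t a * u c * (t a)⁻¹ = t a * (u b * u c * (u b)⁻¹) * (t a)⁻¹ := by rw [this]
    _ = _ := by group

theorem cent_u {b : F} (hb : b ≠ 0) {g : SL F} (h : g * u b = u b * g) :
    g 1 0 = 0 ∧ g 0 0 = g 1 1 := by
  have h1 := congrArg (fun g : SL F => g 0 0) h
  have h2 := congrArg (fun g : SL F => g 0 1) h
  simp only [mul00, mul01, mul10, mul11, u00, u01, u10, u11] at h1 h2
  have h3 : g 1 0 = 0 := by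
    have : b * g 1 0 = 0 := by linear_combination -h1
    exact (mul_eq_zero.1 this).resolve_left hb
  refine ⟨h3, ?_⟩
  have : b * (g 0 0 - g 1 1) = 0 := by linear_combination h2
  exact sub_eq_zero.1 ((mul_eq_zero.1 this).resolve_left hb)

end basic

section finite
variable {F : Type} [Field F] [Finite F]

noncomputable def BEquiv : (Fˣ × F) ≃ B F :=
  Equiv.ofBijective (fun p => ⟨t p.1 * u p.2, (B F).mul_mem (t_mem_B _) (u_mem_B _)⟩) (by
    constructor
    · rintro ⟨a, b⟩ ⟨a', b'⟩ h
      have h := congrArg Subtype.val h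
      simp only at h
      have h1 := congrArg (fun g : SL F => g 0 0) h
      have h2 := congrArg (fun g : SL F => g 0 1) h
      simp only [mul00, mul01, mul10, mul11, u00, u01, u10, u11, t00, t01, t10, t11] at h1 h2
      simp at h1 h2
      have : a = a' := Units.ext h1
      subst this
      simpa using h2
    · rintro ⟨g, hg⟩
      obtain ⟨a, b, rfl⟩ := B_decomp hg
      exact ⟨⟨a, b⟩, rfl⟩)

noncomputable def CEquiv : (F × Fˣ × F) ≃ {g : SL F // g ∉ B F} :=
  Equiv.ofBijective (fun p => ⟨u p.1 * m p.2.1 * u p.2.2, by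
      rw [mem_B, u_m_u_10]; exact p.2.1.ne_zero⟩) (by
    constructor
    · rintro ⟨a, b, c⟩ ⟨a', b', c'⟩ h
      have h := congrArg Subtype.val h
      simp only at h
      have h1 := congrArg (fun g : SL F => g 1 0) h
      have h2 := congrArg (fun g : SL F => g 0 0) h
      have h3 := congrArg (fun g : SL F => g 1 1) h
      simp only [u_m_u_10, u_m_u_00, u_m_u_11] at h1 h2 h3
      have : b = b' := Units.ext h1
      subst this
      simp at h2 h3
      rw [h2, h3]
    · rintro ⟨g, hg⟩
      obtain ⟨a, b, c, rfl⟩ := bruhat hg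
      exact ⟨⟨a, b, c⟩, rfl⟩)

theorem card_units' : Nat.card Fˣ = Nat.card F - 1 := Nat.card_units F

theorem card_B : Nat.card (B F) = (Nat.card F - 1) * Nat.card F := by
  rw [← Nat.card_congr BEquiv, Nat.card_prod, card_units']

theorem card_S : Nat.card (SL F) = (Nat.card F + 1) * ((Nat.card F - 1) * Nat.card F) := by
  classical
  have h := Nat.card_congr (Equiv.sumCompl (fun g : SL F => g ∈ B F))
  rw [Nat.card_sum] at h
  have h2 := Nat.card_congr (CEquiv (F := F))
  rw [Nat.card_prod, Nat.card_prod, card_units'] at h2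
  rw [← h, ← h2]
  have := card_B (F := F)
  change Nat.card (B F) + _ = _
  rw [this]; ring

theorem card_U : Nat.card (U F) = Nat.card F := by
  refine (Nat.card_congr (Equiv.ofBijective (fun b : F => (⟨u b, u_mem b⟩ : U F)) ⟨?_, ?_⟩)).symm
  · intro a b h
    exact u_inj (congrArg Subtype.val h)
  · rintro ⟨_, b, rfl⟩
    exact ⟨b, rfl⟩

theorem index_B : (B F).index = Nat.card F + 1 := by
  have := (B F).index_mul_card
  rw [card_S, card_B] at this
  refine Nat.eq_of_mul_eq_mul_right ?_ this
  rw [← card_B]; exact Nat.card_pos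

end finite

section char2
variable {F : Type} [Field F] [CharP F 2]

theorem cent_u2 {b : F} (hb : b ≠ 0) {g : SL F} (h : g * u b = u b * g) : g ∈ U F := by
  obtain ⟨h1, h2⟩ := cent_u hb h
  have hd := det4 g
  rw [h1, mul_zero, sub_zero, ← h2] at hd
  have h3 : g 0 0 = 1 := by
    have : (g 0 0 - 1) ^ 2 = 0 := by
      linear_combination hd + (1 - g 0 0) * CharTwo.two_eq_zero (R := F)
    exact sub_eq_zero.1 (pow_eq_zero_iff (two_ne_zero)|>.1 this)
  refine ⟨g 0 1, ?_⟩
  apply ext4 <;> simp [← h2, h1, h3]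

theorem center_eq_bot : Subgroup.center (SL F) = ⊥ := by
  rw [eq_bot_iff]
  intro g hg
  rw [Subgroup.mem_center_iff] at hg
  have h1 := cent_u2 (one_ne_zero (α := F)) (hg (u 1)).symm
  obtain ⟨b, rfl⟩ := h1
  have h2 := hg (m 1)
  have h1 := congrArg (fun g : SL F => g 1 1) h2
  simp only [mul00, mul01, mul10, mul11, u00, u01, u10, u11, m00, m01, m10, m11] at h1
  simp at h1
  rw [h1, u_zero]; exact Subgroup.one_mem _

/-- PSL = SL -/
noncomputable def pslEquiv : SL F ≃* PSL2 F :=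
  (QuotientGroup.quotientBot (G := SL F)).symm.trans
    (QuotientGroup.quotientMulEquivOfEq center_eq_bot.symm)

variable [Finite F]

theorem sq_surj (x : F) : ∃ y, y ^ 2 = x := by
  have : Function.Surjective (frobenius F 2) :=
    Finite.surjective_of_injective (frobenius_inj F 2)
  obtain ⟨y, hy⟩ := this x
  exact ⟨y, hy⟩

theorem t_trans {b b' : F} (hb : b ≠ 0) (hb' : b' ≠ 0) : ∃ a : Fˣ, t a * u b * (t a)⁻¹ = u b' := by
  obtain ⟨y, hy⟩ := sq_surj (b' / b)
  have hy0 : y ≠ 0 := by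
    rintro rfl
    have : b' / b ≠ 0 := div_ne_zero hb' hb
    apply this; rw [← hy]; simp
  refine ⟨Units.mk0 y hy0, ?_⟩
  rw [t_conj_u, Units.val_mk0, hy, div_mul_cancel₀ _ hb]

variable (hq : 4 ≤ Nat.card F)
include hq

theorem simple_S : IsSimpleGroup (SL F) := by
  have := Matrix.ProjectiveSpecialLinearGroup.rank_two_simple (F := F) hq
  have e : SL F ≃* Matrix.ProjectiveSpecialLinearGroup (Fin 2) F := pslEquiv
  have : Nontrivial (SL F) := e.toEquiv.nontrivial
  exact IsSimpleGroup.isSimpleGroup_of_surjective e.symm.toMonoidHom e.symm.surjective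

theorem exists_unit : ∃ a : F, a ≠ 0 ∧ a ^ 2 ≠ 1 := by
  by_contra hcon
  push Not at hcon
  have := Fintype.ofFinite F
  have : ∀ a : F, a = 0 ∨ a = 1 := by
    intro a
    by_cases h : a = 0
    · exact Or.inl h
    · right
      have h2 := hcon a h
      have : (a - 1) ^ 2 = 0 := by
        linear_combination h2 + (1 - a) * CharTwo.two_eq_zero (R := F)
      exact sub_eq_zero.1 (pow_eq_zero_iff (two_ne_zero)|>.1 this)
  classical
  have h3 : (Finset.univ : Finset F) ⊆ {0, 1} := by
    intro a _
    simpa using this a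
  have := Finset.card_le_card h3
  rw [Finset.card_univ, ← Nat.card_eq_fintype_card] at this
  have := this.trans Finset.card_le_two
  omega

theorem perfect_S : commutator (SL F) = ⊤ := by
  have hs := simple_S hq
  rcases hs.eq_bot_or_eq_top_of_normal (commutator (SL F)) inferInstance with h | h
  · exfalso
    obtain ⟨a, ha, ha2⟩ := exists_unit hq
    have h1 : ⁅t (Units.mk0 a ha), u 1⁆ ∈ commutator (SL F) :=
      Subgroup.commutator_mem_commutator (Subgroup.mem_top _) (Subgroup.mem_top _)
    rw [h, Subgroup.mem_bot, commutatorElement_def, t_conj_u, mul_inv_eq_one] at h1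
    have := u_inj h1
    simp at this
    rcases this with h | h
    · exact ha2 (by rw [h]; simp)
    · exact ha2 (by rw [h]; simp)
  · exact h

end char2
end KT

namespace KT
open Matrix
open scoped commutatorElement

theorem orbit_span {Γ V : Type} [Group Γ] [AddCommGroup V] [Module ℂ V]
    {ρ : Representation ℂ Γ V} (hρ : Irr ρ) {v : V} (hv0 : v ≠ 0) :
    Submodule.span ℂ (Set.range fun x => ρ x v) = ⊤ := by
  refine hρ.eq_top_of _ ?_ (v := v) (Submodule.subset_span ⟨1, by simp⟩) hv0
  intro g
  have : Submodule.span ℂ (Set.range fun x => ρ x v) ≤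
      Submodule.comap (ρ g) (Submodule.span ℂ (Set.range fun x => ρ x v)) := by
    rw [Submodule.span_le]
    rintro _ ⟨x, rfl⟩
    refine Submodule.subset_span ⟨g * x, ?_⟩
    simp
  exact this

section deg
variable {F : Type} [Field F] [CharP F 2] [Fintype F]

theorem exists_psi : ∃ ψ : AddChar F ℂ, ψ.IsPrimitive := by
  obtain ⟨ψ, hψ⟩ := AddChar.exists_apply_ne_zero.2 (one_ne_zero (α := F))
  refine ⟨ψ, AddChar.IsPrimitive.of_ne_one ?_⟩
  rintro rfl
  exact hψ (by simp)

theorem psi_sq (ψ : AddChar F ℂ) (b : F) : ψ b * ψ b = 1 := by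
  rw [← AddChar.map_add_eq_mul, CharTwo.add_self_eq_zero, AddChar.map_zero_eq_one]

variable {V : Type} [AddCommGroup V] [Module ℂ V] [FiniteDimensional ℂ V]
  (ρ : Representation ℂ (SL F) V) (ψ : AddChar F ℂ)

/-- weight space -/
def Wt (c : F) : Submodule ℂ V where
  carrier := {v | ∀ b, ρ (u b) v = ψ (c * b) • v}
  add_mem' := by
    intro x y hx hy b
    rw [map_add, hx b, hy b, smul_add]
  zero_mem' := by intro b; simp
  smul_mem' := by
    intro a x hx b
    rw [map_smul, hx b, smul_comm]

theorem mem_Wt {c : F} {v : V} : v ∈ Wt ρ ψ c ↔ ∀ b, ρ (u b) v = ψ (c * b) • v := Iff.rfl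

/-- projection -/
noncomputable def E (c : F) : V →ₗ[ℂ] V :=
  (Fintype.card F : ℂ)⁻¹ • ∑ b, ψ (c * b) • ρ (u b)

theorem E_apply (c : F) (v : V) :
    E ρ ψ c v = (Fintype.card F : ℂ)⁻¹ • ∑ b, ψ (c * b) • ρ (u b) v := by
  simp [E, LinearMap.sum_apply]

theorem q_ne : (Fintype.card F : ℂ) ≠ 0 := by
  simp

theorem u_E (c r : F) (v : V) : ρ (u r) (E ρ ψ c v) = ψ (c * r) • E ρ ψ c v := by
  rw [E_apply, map_smul, smul_comm]
  congr 1
  rw [map_sum, Finset.smul_sum]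
  refine Fintype.sum_equiv (Equiv.addLeft r) _ _ fun b => ?_
  rw [map_smul, Equiv.coe_addLeft]
  simp only []
  rw [u_add, map_mul ρ, Module.End.mul_apply, smul_smul, mul_add,
    AddChar.map_add_eq_mul, ← mul_assoc, psi_sq, one_mul]

theorem E_u (c r : F) (v : V) : E ρ ψ c (ρ (u r) v) = ψ (c * r) • E ρ ψ c v := by
  rw [← u_E, E_apply, E_apply, map_smul, map_sum]
  congr 1
  refine Finset.sum_congr rfl fun b _ => ?_
  rw [map_smul, ← Module.End.mul_apply, ← Module.End.mul_apply, ← map_mul, ← map_mul, ← u_add,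
    ← u_add, add_comm]

theorem E_mem (c : F) (v : V) : E ρ ψ c v ∈ Wt ρ ψ c := fun r => u_E ρ ψ c r v

theorem E_eq_self {c : F} {v : V} (hv : v ∈ Wt ρ ψ c) : E ρ ψ c v = v := by
  rw [E_apply]
  have : ∀ b, ψ (c * b) • ρ (u b) v = v := by
    intro b
    rw [hv b, smul_smul, psi_sq, one_smul]
  simp only [this]
  rw [Finset.sum_const, Finset.card_univ, ← Nat.cast_smul_eq_nsmul ℂ, smul_smul,
    inv_mul_cancel₀ q_ne, one_smul]

variable {ψ} (hψ : ψ.IsPrimitive)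
include hψ

theorem psi_sep {c d : F} (h : c ≠ d) : ∃ b, ψ (c * b) ≠ ψ (d * b) := by
  have := hψ (sub_ne_zero.2 h)
  obtain ⟨b, hb⟩ := AddChar.ne_one_iff.1 this
  refine ⟨b, fun he => hb ?_⟩
  rw [AddChar.mulShift_apply, sub_mul, AddChar.map_sub_eq_div, he, div_self]
  exact left_ne_zero_of_mul_eq_one (psi_sq ψ _)

theorem E_eq_zero {c d : F} (h : c ≠ d) {v : V} (hv : v ∈ Wt ρ ψ d) : E ρ ψ c v = 0 := by
  obtain ⟨b, hb⟩ := psi_sep hψ h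
  have h1 := E_u ρ ψ c b v
  rw [hv b, map_smul, ← sub_eq_zero, ← sub_smul] at h1
  exact (smul_eq_zero.1 h1).resolve_left (sub_ne_zero.2 hb.symm)

theorem sum_E (v : V) : ∑ c, E ρ ψ c v = v := by
  classical
  simp only [E_apply]
  rw [← Finset.smul_sum, Finset.sum_comm]
  simp only [← Finset.sum_smul, AddChar.sum_mulShift _ hψ]
  rw [Finset.sum_eq_single 0]
  · rw [if_pos rfl, u_zero, map_one]
    simp only [Module.End.one_apply]
    rw [smul_smul, inv_mul_cancel₀ q_ne, one_smul]
  · intro b _ hb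
    simp [hb]
  · simp

theorem wt_equiv_dim (c : Fˣ) : Module.finrank ℂ (Wt ρ ψ (c : F)) = Module.finrank ℂ (Wt ρ ψ (1 : F)) := by
  obtain ⟨y, hy⟩ := sq_surj (c : F)
  have hy0 : y ≠ 0 := by
    rintro rfl
    exact c.ne_zero (by rw [← hy]; simp)
  let a := Units.mk0 y hy0
  have key : ∀ (a : Fˣ) (c : F) (v : V), v ∈ Wt ρ ψ c → ρ (t a) v ∈ Wt ρ ψ (c * (a : F)⁻¹ ^ 2) := by
    intro a c v hv b
    have h1 : u b * t a = t a * u ((a : F)⁻¹ ^ 2 * b) := by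
      have := t_conj_u a ((a : F)⁻¹ ^ 2 * b)
      rw [← mul_assoc, ← mul_pow, mul_inv_cancel₀ a.ne_zero, one_pow, one_mul] at this
      rw [← this]; group
    rw [← Module.End.mul_apply, ← map_mul, h1, map_mul, Module.End.mul_apply, hv, map_smul, mul_assoc]
  have hinj : ∀ g, Function.Injective (ρ g) := by
    intro g x y hxy
    have := congrArg (ρ g⁻¹) hxy
    simpa [← Module.End.mul_apply, ← map_mul] using this
  apply le_antisymm
  · have h2 : (Wt ρ ψ (c : F)).map (ρ (t a)) ≤ Wt ρ ψ 1 := by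
      rintro _ ⟨v, hv, rfl⟩
      have := key a c v hv
      have h3 : (c : F) * (a : F)⁻¹ ^ 2 = 1 := by
        rw [← hy]; simp [a]; field_simp
      rwa [h3] at this
    rw [LinearEquiv.finrank_eq (Submodule.equivMapOfInjective (ρ (t a)) (hinj _) _)]
    exact Submodule.finrank_mono h2
  · have h2 : (Wt ρ ψ (1 : F)).map (ρ (t a⁻¹)) ≤ Wt ρ ψ c := by
      rintro _ ⟨v, hv, rfl⟩
      have := key a⁻¹ 1 v hv
      have h3 : (1 : F) * ((a⁻¹ : Fˣ) : F)⁻¹ ^ 2 = c := by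
        rw [← hy]; simp [a]
      rwa [h3] at this
    rw [LinearEquiv.finrank_eq (Submodule.equivMapOfInjective (ρ (t a⁻¹)) (hinj _) _)]
    exact Submodule.finrank_mono h2

theorem wdim : Module.finrank ℂ V = Module.finrank ℂ (Wt ρ ψ 0) +
    (Nat.card F - 1) * Module.finrank ℂ (Wt ρ ψ 1) := by
  classical
  let Φ : (∀ c, Wt ρ ψ c) →ₗ[ℂ] V := ∑ c, (Wt ρ ψ c).subtype ∘ₗ LinearMap.proj c
  have hΦ : ∀ f, Φ f = ∑ c, (f c : V) := by
    intro f; simp [Φ, LinearMap.sum_apply]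
  have hinj : Function.Injective Φ := by
    rw [← LinearMap.ker_eq_bot, eq_bot_iff]
    intro f hf
    rw [LinearMap.mem_ker, hΦ] at hf
    have := weights_indep (fun b => ρ (u b)) (fun c b => ψ (c * b))
      (fun c d h => psi_sep hψ h) Finset.univ (fun c => (f c : V)) (fun c b => (f c).2 b) hf
    rw [Submodule.mem_bot]
    funext c
    exact Subtype.ext (this c (Finset.mem_univ _))
  have hsurj : Function.Surjective Φ := by
    intro v
    refine ⟨fun c => ⟨E ρ ψ c v, E_mem ρ ψ c v⟩, ?_⟩
    rw [hΦ]; exact sum_E ρ hψ v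
  rw [← LinearEquiv.finrank_eq (LinearEquiv.ofBijective Φ ⟨hinj, hsurj⟩), Module.finrank_pi_fintype,
    ← Finset.add_sum_erase _ _ (Finset.mem_univ 0)]
  congr 1
  rw [Finset.sum_congr rfl (g := fun _ => Module.finrank ℂ (Wt ρ ψ 1)), Finset.sum_const,
    Finset.card_erase_of_mem (Finset.mem_univ _), Finset.card_univ, smul_eq_mul,
    Nat.card_eq_fintype_card]
  intro c hc
  exact wt_equiv_dim ρ hψ (Units.mk0 c (Finset.ne_of_mem_erase hc))

omit hψ in
/-- the anti-automorphism -/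
def io (g : SL F) : SL F := mk (g 1 1) (g 0 1) (g 1 0) (g 0 0) (by rw [mul_comm (g 1 1)]; exact det4 g)

omit hψ in
theorem io_mul (g h : SL F) : io (g * h) = io h * io g := by
  apply ext4 <;> simp only [mul00, mul01, mul10, mul11, io, mk00, mk01, mk10, mk11] <;> ring
omit hψ in
theorem io_u (b : F) : io (u b) = u b := by apply ext4 <;> simp [io]
omit hψ in
theorem io_m (b : Fˣ) : io (m b) = m b := by apply ext4 <;> simp [io]
omit hψ in
theorem io_t (b : Fˣ) : io (t b) = t b⁻¹ := by apply ext4 <;> simp [io]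

theorem A_t {a : Fˣ} (ha : a ≠ 1) (v : V) : E ρ ψ 1 (ρ (t a) (E ρ ψ 1 v)) = 0 := by
  have key : ∀ (a : Fˣ) (c : F) (v : V), v ∈ Wt ρ ψ c → ρ (t a) v ∈ Wt ρ ψ (c * (a : F)⁻¹ ^ 2) := by
    intro a c v hv b
    have h1 : u b * t a = t a * u ((a : F)⁻¹ ^ 2 * b) := by
      have := t_conj_u a ((a : F)⁻¹ ^ 2 * b)
      rw [← mul_assoc, ← mul_pow, mul_inv_cancel₀ a.ne_zero, one_pow, one_mul] at this
      rw [← this]; group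
    rw [← Module.End.mul_apply, ← map_mul, h1, map_mul, Module.End.mul_apply, hv, map_smul, mul_assoc]
  refine E_eq_zero ρ hψ ?_ (key a 1 _ (E_mem ρ ψ 1 v))
  intro h
  apply ha
  rw [one_mul] at h
  have h2 : (a : F)⁻¹ = 1 := frobenius_inj F 2 (by rw [frobenius_def, ← h]; simp)
  exact Units.ext (inv_eq_one.1 h2)

theorem A_io (x : SL F) (v : V) :
    E ρ ψ 1 (ρ x (E ρ ψ 1 v)) = E ρ ψ 1 (ρ (io x) (E ρ ψ 1 v)) := by
  by_cases hx : x ∈ B F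
  · obtain ⟨a, b, rfl⟩ := B_decomp hx
    by_cases ha : a = 1
    · rw [ha, t_one, one_mul, io_u]
    · rw [io_mul, io_u, io_t, map_mul, map_mul, Module.End.mul_apply, Module.End.mul_apply,
        u_E, map_smul, map_smul, A_t ρ hψ ha, E_u, A_t ρ hψ (inv_ne_one.2 ha), smul_zero]
  · obtain ⟨s, c, r, rfl⟩ := bruhat hx
    rw [io_mul, io_mul, io_u, io_u, io_m]
    simp only [map_mul, Module.End.mul_apply]
    simp only [u_E, E_u, map_smul]
    rw [smul_comm]

theorem A_mul (x y : SL F) (v : V) :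
    E ρ ψ 1 (ρ x (E ρ ψ 1 (ρ y (E ρ ψ 1 v)))) = (Fintype.card F : ℂ)⁻¹ • ∑ b, ψ (1 * b) •
      E ρ ψ 1 (ρ (x * u b * y) (E ρ ψ 1 v)) := by
  rw [E_apply ρ ψ 1 (ρ y _), map_smul, map_smul, map_sum, map_sum]
  simp only [map_smul, map_mul, Module.End.mul_apply]

theorem A_comm (x y : SL F) (v : V) :
    E ρ ψ 1 (ρ x (E ρ ψ 1 (ρ y (E ρ ψ 1 v)))) = E ρ ψ 1 (ρ y (E ρ ψ 1 (ρ x (E ρ ψ 1 v)))) := by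
  have h1 : E ρ ψ 1 (ρ x (E ρ ψ 1 (ρ y (E ρ ψ 1 v)))) =
      E ρ ψ 1 (ρ (io y) (E ρ ψ 1 (ρ (io x) (E ρ ψ 1 v)))) := by
    rw [A_mul ρ hψ, A_mul ρ hψ]
    congr 1
    refine Finset.sum_congr rfl fun b _ => ?_
    rw [A_io ρ hψ, io_mul, io_mul, io_u, mul_assoc]
  rw [h1, ← A_io ρ hψ y, A_io ρ hψ x]

theorem wt1_le (hρ : Irr ρ) : Module.finrank ℂ (Wt ρ ψ 1) ≤ 1 := by
  by_cases hW : Wt ρ ψ 1 = ⊥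
  · rw [hW, finrank_bot]; exact zero_le_one
  obtain ⟨v, hv, hv0, hvA⟩ := common_eigvec (fun x : SL F => E ρ ψ 1 ∘ₗ ρ x ∘ₗ E ρ ψ 1) (Wt ρ ψ 1) hW
    (fun x v _ => E_mem ρ ψ 1 _) (fun x y w hw => by
      simp only [LinearMap.comp_apply]
      rw [E_eq_self ρ ψ (E_mem ρ ψ 1 (ρ y _)), E_eq_self ρ ψ (E_mem ρ ψ 1 (ρ x _))]
      exact A_comm ρ hψ x y w)
  have htop : Submodule.span ℂ (Set.range fun x => ρ x v) = ⊤ := by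
    exact orbit_span hρ hv0
  have hle : Wt ρ ψ 1 ≤ Submodule.span ℂ {v} := by
    intro w hw
    rw [← E_eq_self ρ ψ hw]
    have : (⊤ : Submodule ℂ V).map (E ρ ψ 1) ≤ Submodule.span ℂ {v} := by
      rw [← htop, Submodule.map_span_le]
      rintro _ ⟨x, rfl⟩
      obtain ⟨c, hc⟩ := hvA x
      simp only [LinearMap.comp_apply] at hc
      rw [E_eq_self ρ ψ hv] at hc
      simp only [hc]
      exact Submodule.smul_mem _ _ (Submodule.mem_span_singleton_self v)
    exact this ⟨w, trivial, rfl⟩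
  exact (Submodule.finrank_mono hle).trans (finrank_span_singleton hv0).le

theorem dim_le (hρ : Irr ρ) (h0 : Wt ρ ψ 0 ≠ ⊥) : Module.finrank ℂ V ≤ Nat.card F + 1 := by
  obtain ⟨v, hv, hv0, hvt⟩ := common_eigvec (fun a : Fˣ => ρ (t a)) (Wt ρ ψ 0) h0
    (fun a v hv b => by
      rw [mem_Wt] at hv
      have h1 : u b * t a = t a * u ((a : F)⁻¹ ^ 2 * b) := by
        have := t_conj_u a ((a : F)⁻¹ ^ 2 * b)
        rw [← mul_assoc, ← mul_pow, mul_inv_cancel₀ a.ne_zero, one_pow, one_mul] at this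
        rw [← this]; group
      rw [← Module.End.mul_apply, ← map_mul, h1, map_mul, Module.End.mul_apply, hv, map_smul]
      simp)
    (fun a b w _ => by
      rw [← Module.End.mul_apply, ← map_mul, ← t_mul, mul_comm, t_mul, map_mul]; rfl)
  have hvu : ∀ b, ρ (u b) v = v := by
    intro b; rw [hv b]; simp
  have hvB : ∀ g ∈ B F, ∃ c : ℂ, ρ g v = c • v := by
    intro g hg
    obtain ⟨a, b, rfl⟩ := B_decomp hg
    obtain ⟨c, hc⟩ := hvt a
    exact ⟨c, by rw [map_mul, Module.End.mul_apply, hvu, hc]⟩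
  let f : Option F → V := fun o => o.elim v (fun s => ρ (u s * m 1) v)
  have hg : ∀ g, ρ g v ∈ Submodule.span ℂ (Set.range f) := by
    intro g
    by_cases hg : g ∈ B F
    · obtain ⟨c, hc⟩ := hvB g hg
      rw [hc]
      exact Submodule.smul_mem _ _ (Submodule.subset_span ⟨none, rfl⟩)
    · obtain ⟨s, c, r, rfl⟩ := bruhat hg
      have h1 : m c = m 1 * t c := by
        apply ext4 <;> simp only [mul00, mul01, mul10, mul11, t00, t01, t10, t11, m00, m01, m10, m11] <;> simp
      obtain ⟨e, he⟩ := hvt c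
      rw [map_mul, Module.End.mul_apply, hvu, h1, ← mul_assoc, map_mul, Module.End.mul_apply, he, map_smul]
      exact Submodule.smul_mem _ _ (Submodule.subset_span ⟨some s, rfl⟩)
  have htop : Submodule.span ℂ (Set.range fun x => ρ x v) = ⊤ := by
    exact orbit_span hρ hv0
  have htop2 : Submodule.span ℂ (Set.range f) = ⊤ := by
    rw [eq_top_iff, ← htop, Submodule.span_le]
    rintro _ ⟨x, rfl⟩
    exact hg x
  rw [← finrank_top ℂ V, ← htop2]
  refine (finrank_range_le_card f).trans ?_
  rw [Fintype.card_option, Nat.card_eq_fintype_card]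

end deg

/-- Degrees of SL₂(q), q even. -/
theorem deg_S {F : Type} [Field F] [CharP F 2] [Finite F] (hq : 4 ≤ Nat.card F) {n : ℕ}
    (hn : n ∈ charDegrees (SL F)) :
    n = 1 ∨ n = Nat.card F - 1 ∨ n = Nat.card F ∨ n = Nat.card F + 1 := by
  have := Fintype.ofFinite F
  obtain ⟨V, i1, i2, i3, ρ, hρ, rfl⟩ := charDegrees_irr hn
  obtain ⟨ψ, hψ⟩ := exists_psi (F := F)
  have hw := wdim ρ hψ
  have h1 := wt1_le ρ hψ hρ
  have hpos : 0 < Module.finrank ℂ V := by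
    have := hρ.1
    exact Module.finrank_pos
  by_cases h0 : Wt ρ ψ 0 = ⊥
  · rw [h0, finrank_bot, zero_add] at hw
    have : Module.finrank ℂ (Wt ρ ψ 1) = 1 := by
      rcases Nat.le_one_iff_eq_zero_or_eq_one.1 h1 with h | h
      · rw [h] at hw; omega
      · exact h
    rw [this, mul_one] at hw
    exact Or.inr (Or.inl hw)
  · have h2 := dim_le ρ hψ hρ h0
    rcases Nat.le_one_iff_eq_zero_or_eq_one.1 h1 with h | h
    · left
      rw [h, mul_zero, add_zero] at hw
      have htop : Wt ρ ψ 0 = ⊤ := Submodule.eq_top_of_finrank_eq hw.symm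
      have hker : u (1 : F) ∈ MonoidHom.ker ρ := by
        rw [MonoidHom.mem_ker]
        ext v
        have : v ∈ Wt ρ ψ 0 := by rw [htop]; trivial
        rw [this 1]; simp
      have hs := simple_S hq
      have hkt : MonoidHom.ker ρ = ⊤ := by
        rcases hs.eq_bot_or_eq_top_of_normal (MonoidHom.ker ρ) inferInstance with h | h
        · rw [h, Subgroup.mem_bot, ← u_zero] at hker
          exact absurd (u_inj hker) one_ne_zero
        · exact h
      have := hρ.1
      obtain ⟨v, hv⟩ := exists_ne (0 : V)
      have : Submodule.span ℂ {v} = ⊤ := by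
        refine hρ.eq_top_of _ ?_ (Submodule.mem_span_singleton_self v) hv
        intro g w hw
        have : g ∈ MonoidHom.ker ρ := by rw [hkt]; trivial
        rw [MonoidHom.mem_ker.1 this]; exact hw
      rw [← finrank_top ℂ V, ← this, finrank_span_singleton hv]
    · rw [h, mul_one] at hw
      have : 0 < Module.finrank ℂ (Wt ρ ψ 0) := by
        have := Submodule.nontrivial_iff_ne_bot.2 h0
        exact Module.finrank_pos
      omega

end KT

namespace KT
open Matrix
open scoped commutatorElement

/-- degree condition -/
def Star (q n : ℕ) : Prop :=
  (n.Coprime q ∨ n.Coprime (q - 1)) ∧ (n.Coprime q ∨ n.Coprime (q + 1)) ∧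
    (n.Coprime (q - 1) ∨ n.Coprime (q + 1))

theorem Star.of_dvd {q n k : ℕ} (h : Star q n) (hk : k ∣ n) : Star q k :=
  ⟨h.1.imp (Nat.Coprime.of_dvd_left hk) (Nat.Coprime.of_dvd_left hk),
    h.2.1.imp (Nat.Coprime.of_dvd_left hk) (Nat.Coprime.of_dvd_left hk),
    h.2.2.imp (Nat.Coprime.of_dvd_left hk) (Nat.Coprime.of_dvd_left hk)⟩

theorem coprime_cover {S : Type} [Group S] [Finite S] (H K : Subgroup S)
    (hc : H.index.Coprime K.index) (g : S) : ∃ k ∈ K, k * g ∈ H := by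
  classical
  let f : ↥K ⧸ H.subgroupOf K → S ⧸ H := Quotient.lift (fun k => ((k : S) : S ⧸ H)) (by
    intro a b hab
    have := QuotientGroup.leftRel_apply.1 hab
    exact QuotientGroup.eq.2 this)
  have hf : Function.Injective f := by
    intro a b
    induction a using QuotientGroup.induction_on with | _ a =>
    induction b using QuotientGroup.induction_on with | _ b =>
    intro h
    have h1 : ((a : S) : S ⧸ H) = ((b : S) : S ⧸ H) := h
    have h2 := QuotientGroup.eq.1 h1
    exact QuotientGroup.eq.2 h2
  have hcard : H.index ∣ H.relIndex K := by
    have h1 : (H ⊓ K).index = H.relIndex K * K.index := by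
      rw [← Subgroup.inf_relIndex_right, Subgroup.relIndex_mul_index inf_le_right]
    have h2 : H.index ∣ (H ⊓ K).index := Subgroup.index_dvd_of_le inf_le_left
    rw [h1] at h2
    exact hc.dvd_of_dvd_mul_right h2
  have hcard2 : Nat.card (S ⧸ H) ≤ Nat.card (↥K ⧸ H.subgroupOf K) :=
    Nat.le_of_dvd Nat.card_pos hcard
  have hsurj : Function.Surjective f := by
    exact ((Nat.bijective_iff_injective_and_card f).2
      ⟨hf, le_antisymm (Nat.card_le_card_of_injective f hf) hcard2⟩).2
  obtain ⟨k, hk⟩ := hsurj (g : S ⧸ H)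
  induction k using QuotientGroup.induction_on with | _ k =>
  have h1 : ((k : S) : S ⧸ H) = (g : S ⧸ H) := hk
  exact ⟨(k : S)⁻¹, K.inv_mem k.2, QuotientGroup.eq.1 h1⟩

section A
variable {F : Type} [Field F] [CharP F 2] [Finite F]

theorem even_aux (K : Subgroup (SL F)) (h1 : ∀ g, ∃ s : F, u s * g ∈ K)
    (h2 : ∀ b : F, u b ∈ K → b = 0) {a : Fˣ} (ha2 : (a : F) ^ 2 ≠ 1) (hta : t a ∈ K) : False := by
  obtain ⟨s, hs⟩ := h1 (m 1)
  have h3 : t a * (u s * m 1) * (t a)⁻¹ = t a * t a * (u (((a : F)⁻¹) ^ 2 * s) * m 1) := by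
    rw [t_inv]
    have := a.ne_zero
    apply ext4 <;> simp only [mul00, mul01, mul10, mul11, t00, t01, t10, t11, m00, m01, m10, m11,
      u00, u01, u10, u11] <;> simp <;> field_simp
  have h4 : u (((a : F)⁻¹) ^ 2 * s) * m 1 ∈ K := by
    have h5 := K.mul_mem (K.mul_mem hta hs) (K.inv_mem hta)
    rw [h3] at h5
    exact (K.mul_mem_cancel_left (K.mul_mem hta hta)).1 h5
  have h6 := K.mul_mem h4 (K.inv_mem hs)
  have h7 : u (((a : F)⁻¹) ^ 2 * s) * m 1 * (u s * m 1)⁻¹ = u (((a : F)⁻¹) ^ 2 * s - s) := by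
    rw [sub_eq_add_neg, u_add, ← u_inv]; group
  rw [h7] at h6
  have h8 := h2 _ h6
  have h9 : (((a : F)⁻¹) ^ 2 - 1) * s = 0 := by linear_combination h8
  have hs0 : s = 0 := by
    refine (mul_eq_zero.1 h9).resolve_left fun h => ha2 ?_
    have h10 := sub_eq_zero.1 h
    rw [inv_pow, inv_eq_one] at h10
    exact h10
  rw [hs0, u_zero, one_mul] at hs
  let p : SL F := mk 1 0 1 1 (by ring)
  obtain ⟨r, hr⟩ := h1 p⁻¹
  have h11 := K.mul_mem (K.mul_mem hr hs) (K.inv_mem hr)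
  have h12 : p⁻¹ * m 1 * p = u 1 := by
    apply ext4 <;> simp [p, mul00, mul01, mul10, mul11, inv00, inv01, inv10, inv11, CharTwo.neg_eq,
      CharTwo.add_self_eq_zero]
  have h13 : u r * p⁻¹ * m 1 * (u r * p⁻¹)⁻¹ = u 1 := by
    calc u r * p⁻¹ * m 1 * (u r * p⁻¹)⁻¹ = u r * (p⁻¹ * m 1 * p) * (u r)⁻¹ := by group
      _ = u 1 := by rw [h12, ← u_add, add_comm, u_add]; group
  rw [h13] at h11
  exact one_ne_zero (h2 _ h11)

theorem even_index (hq : 4 ≤ Nat.card F) (H : Subgroup (SL F)) (hH : H ≠ ⊤)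
    (h1 : ∀ g, ∃ s : F, u s * g ∈ H) : False := by
  have h2 : ∀ b : F, u b ∈ H → b = 0 := by
    intro b hb
    by_contra hb0
    have hs := simple_S hq
    rcases hs.eq_bot_or_eq_top_of_normal H.normalCore inferInstance with h | h
    · have : u b ∈ H.normalCore := by
        intro g
        obtain ⟨s, hs⟩ := h1 g⁻¹
        have h3 := H.mul_mem (H.mul_mem (H.inv_mem hs) hb) hs
        have h4 : (u s * g⁻¹)⁻¹ * u b * (u s * g⁻¹) = g * ((u s)⁻¹ * (u b * u s)) * g⁻¹ := by group
        rw [h4, ← u_add, add_comm, u_add, inv_mul_cancel_left] at h3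
        exact h3
      rw [h, Subgroup.mem_bot, ← u_zero] at this
      exact hb0 (u_inj this)
    · exact hH (eq_top_iff.2 (h ▸ H.normalCore_le))
  obtain ⟨a, ha, ha2⟩ := exists_unit hq
  obtain ⟨r, hr⟩ := h1 (t (Units.mk0 a ha))
  have ha3 : a ^ 2 - 1 ≠ 0 := sub_ne_zero.2 ha2
  let s : F := r / (a ^ 2 - 1)
  refine even_aux (H.comap (MulAut.conj (u (-s))).toMonoidHom) ?_ ?_ (a := Units.mk0 a ha) ha2 ?_
  · intro g
    obtain ⟨r, hr⟩ := h1 (u (-s) * g * (u (-s))⁻¹)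
    refine ⟨r, ?_⟩
    rw [Subgroup.mem_comap]
    change u (-s) * (u r * g) * (u (-s))⁻¹ ∈ H
    rwa [← mul_assoc, ← u_add, add_comm, u_add, mul_assoc, mul_assoc, ← mul_assoc (u (-s))]
  · intro b hb
    apply h2
    have : u (-s) * u b * (u (-s))⁻¹ ∈ H := hb
    rwa [← u_add, add_comm, u_add, mul_assoc, mul_inv_cancel, mul_one] at this
  · change u (-s) * t (Units.mk0 a ha) * (u (-s))⁻¹ ∈ H
    convert hr using 1
    rw [u_inv]
    apply ext4 <;> simp [mul00, mul01, mul10, mul11]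
    simp only [s]
    field_simp
    ring

omit [CharP F 2] [Finite F] in
theorem gen_aux (H : Subgroup (SL F)) (hU : U F ≤ H) (hB : ¬ H ≤ B F) : H = ⊤ := by
  obtain ⟨x, hx, hxB⟩ := Set.not_subset.1 hB
  obtain ⟨s, c, r, rfl⟩ := bruhat hxB
  have hu : ∀ b : F, u b ∈ H := fun b => hU (u_mem b)
  have hm : m c ∈ H := by
    have := (H.mul_mem_cancel_right (hu r)).1 hx
    exact (H.mul_mem_cancel_left (hu s)).1 this
  have hl : ∀ y : F, mk 1 0 y 1 (by ring) ∈ H := by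
    intro y
    have h1 := H.mul_mem (H.mul_mem hm (hu (-(y / c ^ 2)))) (H.inv_mem hm)
    convert h1 using 1
    have := c.ne_zero
    apply ext4 <;> simp [mul00, mul01, mul10, mul11, inv00, inv01, inv10, inv11]
    field_simp
  have hm2 : ∀ y : Fˣ, m y ∈ H := by
    intro y
    have h1 := H.mul_mem (H.mul_mem (hu (-(y : F)⁻¹)) (hl y)) (hu (-(y : F)⁻¹))
    convert h1 using 1
    apply ext4 <;> simp [mul00, mul01, mul10, mul11]
  have ht : ∀ y : Fˣ, t y ∈ H := by
    intro y
    have h1 : m y = m 1 * t y := by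
      apply ext4 <;> simp only [mul00, mul01, mul10, mul11, t00, t01, t10, t11, m00, m01, m10, m11] <;> simp
    have h2 := hm2 y
    rw [h1] at h2
    exact (H.mul_mem_cancel_left (hm2 1)).1 h2
  rw [eq_top_iff]
  intro g _
  by_cases hg : g ∈ B F
  · obtain ⟨a, b, rfl⟩ := B_decomp hg
    exact H.mul_mem (ht a) (hu b)
  · obtain ⟨s, c, r, rfl⟩ := bruhat hg
    exact H.mul_mem (H.mul_mem (hu s) (hm2 c)) (hu r)

/-- q is a power of two. -/
theorem q_pow (hq : 4 ≤ Nat.card F) : ∃ f, 2 ≤ f ∧ Nat.card F = 2 ^ f := by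
  have := Fintype.ofFinite F
  obtain ⟨n, hp, hn⟩ := FiniteField.card F 2
  refine ⟨n, ?_, by rw [Nat.card_eq_fintype_card, hn]⟩
  by_contra h
  rw [Nat.card_eq_fintype_card, hn] at hq
  have : (n : ℕ) ≤ 1 := by omega
  have := Nat.pow_le_pow_right (n := 2) (by norm_num) this
  omega

theorem odd_pm (hq : 4 ≤ Nat.card F) : Even (Nat.card F) ∧ Odd (Nat.card F - 1) ∧ Odd (Nat.card F + 1) := by
  obtain ⟨f, hf, hF⟩ := q_pow hq
  have : Even (Nat.card F) := by
    rw [hF]; exact (Nat.even_pow' (by omega)).2 even_two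
  refine ⟨this, ?_, this.add_one⟩
  exact Nat.Even.sub_odd (by omega) this odd_one

theorem cop1 (hq : 4 ≤ Nat.card F) : (Nat.card F).Coprime (Nat.card F - 1) := by
  rw [Nat.coprime_comm, Nat.coprime_self_sub_left (by omega)]; exact Nat.coprime_one_left _
theorem cop2 : (Nat.card F).Coprime (Nat.card F + 1) := by simp
theorem cop3 (hq : 4 ≤ Nat.card F) : (Nat.card F - 1).Coprime (Nat.card F + 1) := by
  obtain ⟨h1, h2, h3⟩ := odd_pm hq
  have : Nat.card F + 1 = (Nat.card F - 1) + 2 := by omega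
  rw [this, Nat.coprime_self_add_right]
  exact h2.coprime_two_right

theorem sylow_conj (hq : 4 ≤ Nat.card F) (K : Subgroup (SL F)) (hK : Nat.card K = Nat.card F) :
    ∃ s, K.map (MulAut.conj s).toMonoidHom = U F := by
  obtain ⟨f, hf, hF⟩ := q_pow hq
  obtain ⟨h1, h2, h3⟩ := odd_pm hq
  have : Fact (Nat.Prime 2) := ⟨Nat.prime_two⟩
  have hfac : Nat.card F = 2 ^ (Nat.card (SL F)).factorization 2 := by
    rw [card_S, Nat.factorization_mul (by omega)
      (Nat.mul_ne_zero (by omega) (by omega)), Nat.factorization_mul (by omega) (by omega)]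
    simp only [Finsupp.add_apply]
    rw [Nat.factorization_eq_zero_of_not_dvd (n := _ + 1) (fun h => (Nat.not_even_iff_odd.2 h3) (even_iff_two_dvd.2 h)),
      Nat.factorization_eq_zero_of_not_dvd (n := _ - 1) (fun h => (Nat.not_even_iff_odd.2 h2) (even_iff_two_dvd.2 h)), hF,
      Nat.Prime.factorization_pow Nat.prime_two]
    simp
  let P1 : Sylow 2 (SL F) := Sylow.ofCard K (hK.trans hfac)
  let P2 : Sylow 2 (SL F) := Sylow.ofCard (U F) (card_U.trans hfac)
  obtain ⟨s, hs⟩ := MulAction.exists_smul_eq (SL F) P1 P2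
  refine ⟨s, ?_⟩
  have := congrArg (fun P : Sylow 2 (SL F) => (P : Subgroup (SL F))) hs
  exact this

theorem index_star (hq : 4 ≤ Nat.card F) (H : Subgroup (SL F)) (hH : H ≠ ⊤)
    (hst : Star (Nat.card F) H.index) : ∃ s, H.map (MulAut.conj s).toMonoidHom = B F := by
  have hi1 : H.index ≠ 1 := fun h => hH (Subgroup.index_eq_one.1 h)
  have hcard := H.card_mul_index
  rw [card_S] at hcard
  by_cases hev : H.index.Coprime (Nat.card F)
  · -- odd
    have hd : Nat.card F ∣ Nat.card H := by
      have : Nat.card F ∣ Nat.card H * H.index := by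
        rw [hcard, ← mul_assoc]; exact dvd_mul_left _ _
      exact hev.symm.dvd_of_dvd_mul_right this
    obtain ⟨f, hf, hF⟩ := q_pow hq
    have : Fact (Nat.Prime 2) := ⟨Nat.prime_two⟩
    obtain ⟨K, hK⟩ := Sylow.exists_subgroup_card_pow_prime 2 (hF ▸ hd)
    have hK2 : Nat.card (K.map H.subtype) = Nat.card F := by
      rw [Subgroup.card_map_of_injective H.subtype_injective, hK, hF]
    obtain ⟨s, hs⟩ := sylow_conj hq _ hK2
    refine ⟨s, ?_⟩
    have hidx : (H.map (MulAut.conj s).toMonoidHom).index = H.index :=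
      Subgroup.index_map_equiv H (MulAut.conj s)
    set H' := H.map (MulAut.conj s).toMonoidHom with hH'
    have hUH : U F ≤ H' := by
      rw [← hs]
      apply Subgroup.map_mono
      exact Subgroup.map_subtype_le K
    have hHB : H' ≤ B F := by
      by_contra hcon
      have := gen_aux H' hUH hcon
      rw [this, Subgroup.index_top] at hidx
      exact hi1 hidx.symm
    have h1 := Subgroup.relIndex_mul_index hHB
    rw [index_B, hidx] at h1
    have h2 : H'.relIndex (B F) ∣ (Nat.card F - 1) := by
      have h3 : H'.relIndex (B F) ∣ (U F).relIndex (B F) := Subgroup.relIndex_dvd_of_le_left _ hUH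
      have h4 := Subgroup.relIndex_mul_index (U_le_B (F := F))
      have h5 := (U F).card_mul_index
      rw [card_U, card_S, ← h4, index_B] at h5
      have h6 : (U F).relIndex (B F) = Nat.card F - 1 := by
        have hpos : 0 < (Nat.card F + 1) * Nat.card F := by positivity
        refine Nat.eq_of_mul_eq_mul_right hpos ?_
        linarith
      rwa [h6] at h3
    have hnc : ¬ H.index.Coprime (Nat.card F + 1) := by
      intro h
      have := Nat.Coprime.eq_one_of_dvd h.symm (h1 ▸ dvd_mul_left _ _)
      omega
    have h7 := hst.2.2.resolve_right hnc
    have h8 : H'.relIndex (B F) = 1 := by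
      have h9 : (H'.relIndex (B F)).Coprime (Nat.card F - 1) :=
        h7.of_dvd_left (h1 ▸ dvd_mul_right _ _)
      exact Nat.Coprime.eq_one_of_dvd h9 h2
    exact le_antisymm hHB (Subgroup.relIndex_eq_one.1 h8)
  · exfalso
    have h1 := hst.1.resolve_left hev
    have h2 := hst.2.1.resolve_left hev
    have hcop : H.index.Coprime (U F).index := by
      have h5 := (U F).card_mul_index
      rw [card_U, card_S] at h5
      have hpos : 0 < Nat.card F := by omega
      have : (U F).index = (Nat.card F + 1) * (Nat.card F - 1) := by
        refine Nat.eq_of_mul_eq_mul_left hpos ?_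
        rw [h5]; ring
      rw [this]
      exact h2.mul_right h1
    refine even_index hq H hH fun g => ?_
    obtain ⟨k, ⟨s, rfl⟩, hk⟩ := coprime_cover H (U F) hcop g
    exact ⟨s, hk⟩

end A
end KT

namespace KT
open Matrix
open scoped commutatorElement

section gen
variable {Γ : Type} [Group Γ]

open Classical in
/-- extension by zero -/
noncomputable def ext0 (A : Subgroup Γ) (l : A →* ℂˣ) : Γ → ℂ :=
  fun x => if h : x ∈ A then (l ⟨x, h⟩ : ℂ) else 0

theorem ext0_apply {A : Subgroup Γ} (l : A →* ℂˣ) {x : Γ} (h : x ∈ A) :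
    ext0 A l x = (l ⟨x, h⟩ : ℂ) := by
  simp [ext0, h]

theorem ext0_ne {A : Subgroup Γ} (l : A →* ℂˣ) {x : Γ} (h : x ∈ A) : ext0 A l x ≠ 0 := by
  rw [ext0_apply l h]; exact (l ⟨x, h⟩).ne_zero

theorem ext0_mul {A : Subgroup Γ} (l : A →* ℂˣ) {x y : Γ} (h : x ∈ A) (h' : y ∈ A) :
    ext0 A l (x * y) = ext0 A l x * ext0 A l y := by
  rw [ext0_apply l h, ext0_apply l h', ext0_apply l (A.mul_mem h h'), ← Units.val_mul, ← map_mul]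
  rfl

/-- stabilizer -/
def stab (Δ A : Subgroup Γ) (hA : ∀ g ∈ Δ, ∀ a ∈ A, g⁻¹ * a * g ∈ A) (χ : Γ → ℂ) : Subgroup Γ where
  carrier := {g | g ∈ Δ ∧ ∀ a ∈ A, χ (g⁻¹ * a * g) = χ a}
  mul_mem' := by
    rintro g h ⟨hg, hg'⟩ ⟨hh, hh'⟩
    refine ⟨Δ.mul_mem hg hh, fun a ha => ?_⟩
    have h1 : (g * h)⁻¹ * a * (g * h) = h⁻¹ * (g⁻¹ * a * g) * h := by group
    rw [h1, hh' _ (hA g hg a ha), hg' a ha]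
  one_mem' := ⟨Δ.one_mem, by simp⟩
  inv_mem' := by
    rintro g ⟨hg, hg'⟩
    refine ⟨Δ.inv_mem hg, fun a ha => ?_⟩
    have h1 := hA _ (Δ.inv_mem hg) a ha
    rw [← hg' _ h1]
    congr 1
    group

theorem mem_stab {Δ A : Subgroup Γ} {hA : ∀ g ∈ Δ, ∀ a ∈ A, g⁻¹ * a * g ∈ A} {χ : Γ → ℂ} {g : Γ} :
    g ∈ stab Δ A hA χ ↔ g ∈ Δ ∧ ∀ a ∈ A, χ (g⁻¹ * a * g) = χ a := Iff.rfl

theorem le_stab {Δ A : Subgroup Γ} (hA : ∀ g ∈ Δ, ∀ a ∈ A, g⁻¹ * a * g ∈ A) (l : A →* ℂˣ)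
    (hle : A ≤ Δ) : A ≤ stab Δ A hA (ext0 A l) := by
  intro g hg
  refine ⟨hle hg, fun a ha => ?_⟩
  rw [ext0_mul l (A.mul_mem (A.inv_mem hg) ha) hg, ext0_mul l (A.inv_mem hg) ha, mul_right_comm,
    ← ext0_mul l (A.inv_mem hg) hg, inv_mul_cancel]
  have : ext0 A l 1 = 1 := by
    rw [ext0_apply l A.one_mem]
    have : (⟨1, A.one_mem⟩ : A) = 1 := rfl
    rw [this, map_one]; rfl
  rw [this, one_mul]

variable {V : Type} [AddCommGroup V] [Module ℂ V]

/-- weight space for a subgroup -/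
def wtA (ρ : Representation ℂ Γ V) (A : Subgroup Γ) (χ : Γ → ℂ) : Submodule ℂ V where
  carrier := {v | ∀ a ∈ A, ρ a v = χ a • v}
  add_mem' := by
    intro x y hx hy b hb
    rw [map_add, hx b hb, hy b hb, smul_add]
  zero_mem' := by intro b; simp
  smul_mem' := by
    intro a x hx b hb
    rw [map_smul, hx b hb, smul_comm]

theorem wtA_stab (ρ : Representation ℂ Γ V) {Δ A : Subgroup Γ}
    {hA : ∀ g ∈ Δ, ∀ a ∈ A, g⁻¹ * a * g ∈ A} {χ : Γ → ℂ} {g : Γ} (hg : g ∈ stab Δ A hA χ)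
    {v : V} (hv : v ∈ wtA ρ A χ) : ρ g v ∈ wtA ρ A χ := by
  intro a ha
  have h1 := hv _ (hA g hg.1 a ha)
  rw [hg.2 a ha] at h1
  rw [← map_smul, ← h1, ← Module.End.mul_apply, ← Module.End.mul_apply, ← map_mul, ← map_mul]
  congr 2
  group

variable [Finite Γ] [FiniteDimensional ℂ V]

theorem irr_dim0 {ρ : Representation ℂ Γ V} (hρ : Irr ρ) {A : Subgroup Γ}
    {hA : ∀ g ∈ (⊤ : Subgroup Γ), ∀ a ∈ A, g⁻¹ * a * g ∈ A} {χ : Γ → ℂ}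
    (X : Submodule ℂ V) (hX : X ≤ wtA ρ A χ) (hX0 : X ≠ ⊥)
    (hTX : ∀ g ∈ stab ⊤ A hA χ, ∀ v ∈ X, ρ g v ∈ X) :
    Module.finrank ℂ V = (stab ⊤ A hA χ).index * Module.finrank ℂ X := by
  obtain ⟨Y, hY1, hY2, hY3, -⟩ := imprimitive ρ ⊤ (stab ⊤ A hA χ) A χ le_top hA
    (fun g hg h => ⟨hg, h⟩) X (fun a ha w hw => hX hw a ha) hTX
  obtain ⟨v, hv, hv0⟩ := Submodule.exists_mem_ne_zero_of_ne_bot hX0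
  have := hρ.eq_top_of Y (fun g => hY2 g trivial) (hY1 hv) hv0
  rw [this, finrank_top, Subgroup.relIndex_top_right] at hY3
  exact hY3

theorem two_level {ρ : Representation ℂ Γ V} (hρ : Irr ρ) {A P T : Subgroup Γ}
    {hA : ∀ g ∈ (⊤ : Subgroup Γ), ∀ a ∈ A, g⁻¹ * a * g ∈ A} {χ χ' : Γ → ℂ}
    (hT : stab ⊤ A hA χ = T) (hAP : A ≤ P)
    (hP : ∀ g ∈ T, ∀ a ∈ P, g⁻¹ * a * g ∈ P) (hχ : ∀ a ∈ A, χ' a = χ a)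
    (h0 : wtA ρ P χ' ≠ ⊥) :
    Module.finrank ℂ V = T.index * ((stab T P hP χ').relIndex T * Module.finrank ℂ (wtA ρ P χ')) := by
  subst hT
  obtain ⟨Y, hY1, hY2, hY3, hY4⟩ := imprimitive ρ (stab ⊤ A hA χ) (stab _ P hP χ') P χ'
    (fun g hg => hg.1) hP
    (fun g hg h => ⟨hg, h⟩) (wtA ρ P χ') (fun a ha w hw => hw a ha) (fun g hg v hv => wtA_stab ρ hg hv)
  rw [← hY3]
  refine irr_dim0 hρ Y ?_ ?_ hY2
  · refine hY4 _ ?_ (fun g hg v hv => wtA_stab ρ hg hv)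
    intro v hv a ha
    rw [hv a (hAP ha), hχ a ha]
  · intro hb
    rw [hb, le_bot_iff] at hY1
    exact h0 hY1

omit [Finite Γ] [FiniteDimensional ℂ V] in
theorem eig_hom (ρ : Representation ℂ Γ V) (K : Subgroup Γ) {v : V} (hv : v ≠ 0)
    (h : ∀ k : K, ∃ c : ℂ, ρ (k : Γ) v = c • v) :
    ∃ μ : K →* ℂˣ, ∀ k : K, ρ (k : Γ) v = (μ k : ℂ) • v := by
  choose c hc using h
  let μ : K →* ℂ :=
    { toFun := c
      map_one' := by
        have := hc 1
        simp only [Subgroup.coe_one, map_one, Module.End.one_apply] at this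
        have h2 : (c 1 - 1) • v = 0 := by rw [sub_smul, one_smul, ← this, sub_self]
        exact sub_eq_zero.1 ((smul_eq_zero.1 h2).resolve_right hv)
      map_mul' := by
        intro x y
        have := hc (x * y)
        rw [Subgroup.coe_mul, map_mul, Module.End.mul_apply, hc y, map_smul, hc x, smul_smul] at this
        have h2 : (c y * c x - c (x * y)) • v = 0 := by rw [sub_smul, this, sub_self]
        rw [← sub_eq_zero.1 ((smul_eq_zero.1 h2).resolve_right hv), mul_comm] }
  exact ⟨μ.toHomUnits, fun k => hc k⟩

end gen

section A
variable {F : Type} [Field F] [CharP F 2] [Finite F]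

theorem caseA_B (hq : 4 ≤ Nat.card F) {N : Type} [Group N] [Finite N] (π : N →* SL F)
    (hπ : Function.Surjective π) (hst : ∀ n ∈ charDegrees N, Star (Nat.card F) n)
    (A : Subgroup N) (hA : π.ker = A) (hAn : ∀ g ∈ (⊤ : Subgroup N), ∀ a ∈ A, g⁻¹ * a * g ∈ A)
    (l : A →* ℂˣ) (hT : stab ⊤ A hAn (ext0 A l) = (B F).comap π) : False := by
  have := Fintype.ofFinite F
  obtain ⟨q1, q2, q3⟩ := odd_pm hq
  set P := (U F).comap π with hPdef
  set T := (B F).comap π with hTdef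
  have hAP : A ≤ P := by
    intro a ha
    rw [← hA, MonoidHom.mem_ker] at ha
    rw [hPdef, Subgroup.mem_comap, ha]; exact (U F).one_mem
  have hPTle : P ≤ T := Subgroup.comap_mono U_le_B
  have hP : ∀ g ∈ T, ∀ a ∈ P, g⁻¹ * a * g ∈ P := by
    intro g hg a ha
    rw [hPdef, Subgroup.mem_comap] at ha ⊢
    have := B_conj_U ((B F).inv_mem (Subgroup.mem_comap.1 hg)) ha
    simpa using this
  have hTi : T.index = Nat.card F + 1 := by
    rw [hTdef, Subgroup.index_comap_of_surjective _ hπ, index_B]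
  have hPmem : ∀ x ∈ P, ∃ b, π x = u b := fun x hx => by
    obtain ⟨b, hb⟩ := Subgroup.mem_comap.1 hx
    exact ⟨b, hb.symm⟩
  have hnc : ∀ k, ¬ ((Nat.card F + 1) * k).Coprime (Nat.card F + 1) := by
    intro k h
    have := Nat.Coprime.eq_one_of_dvd h.symm (dvd_mul_right _ _)
    omega
  obtain ⟨V, i1, i2, i3, ρ, hρ, v0, hv0, hv0l⟩ := exists_irr_char A l
  have hv0W : v0 ∈ wtA ρ A (ext0 A l) := by
    intro a ha
    rw [ext0_apply l ha]; exact hv0l ⟨a, ha⟩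
  have hW0 : wtA ρ A (ext0 A l) ≠ ⊥ := fun h => hv0 (by
    rw [h] at hv0W; exact hv0W)
  have hTW : ∀ g ∈ T, ∀ v ∈ wtA ρ A (ext0 A l), ρ g v ∈ wtA ρ A (ext0 A l) := by
    intro g hg v hv
    rw [← hT] at hg
    exact wtA_stab ρ hg hv
  have hdim := irr_dim0 hρ (hA := hAn) _ le_rfl hW0 (fun g hg v hv => wtA_stab ρ hg hv)
  rw [hT, hTi] at hdim
  set W := wtA ρ A (ext0 A l) with hW
  by_cases hcomm : ∀ x y : P, ∀ v ∈ W, ρ (x : N) (ρ (y : N) v) = ρ (y : N) (ρ (x : N) v)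
  · obtain ⟨v, hvW, hv0, hve⟩ := common_eigvec (fun x : P => ρ (x : N)) W hW0
      (fun x v hv => hTW x (hPTle x.2) v hv) hcomm
    obtain ⟨μ, hμ⟩ := eig_hom ρ P hv0 hve
    obtain ⟨ψ, hψ⟩ := exists_psi (F := F)
    let κ0 : P →* ℂ :=
      { toFun := fun p => ψ ((π p) 0 1)
        map_one' := by simp
        map_mul' := by
          intro x y
          obtain ⟨a, ha⟩ := hPmem x x.2
          obtain ⟨b, hb⟩ := hPmem y y.2
          rw [Subgroup.coe_mul, map_mul, ha, hb, ← u_add, u01, u01, u01, AddChar.map_add_eq_mul] }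
    let κ : P →* ℂˣ := κ0.toHomUnits
    have hκ : ∀ p : P, (κ p : ℂ) = ψ ((π p) 0 1) := fun p => rfl
    have hμA : ∀ a (ha : a ∈ A), μ ⟨a, hAP ha⟩ = l ⟨a, ha⟩ := by
      intro a ha
      have h1 := hμ ⟨a, hAP ha⟩
      have h2 := hvW a ha
      rw [ext0_apply l ha] at h2
      rw [h2] at h1
      rw [← sub_eq_zero, ← sub_smul] at h1
      have := sub_eq_zero.1 ((smul_eq_zero.1 h1).resolve_right hv0)
      exact (Units.ext this).symm
    obtain ⟨μ', hμ'A, hμ's⟩ : ∃ μ' : P →* ℂˣ, (∀ a (ha : a ∈ A), μ' ⟨a, hAP ha⟩ = l ⟨a, ha⟩) ∧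
        ¬ T ≤ stab T P hP (ext0 P μ') := by
      by_contra hcon
      push Not at hcon
      have h1 := hcon μ hμA
      have h2 := hcon (μ * κ) (by
        intro a ha
        rw [MonoidHom.mul_apply, hμA a ha]
        have h3 : κ ⟨a, hAP ha⟩ = 1 := by
          apply Units.ext
          rw [hκ]
          have : π a = 1 := by rw [← hA] at ha; exact ha
          simp [this]
        rw [h3, mul_one])
      obtain ⟨e, he0, he2⟩ := exists_unit hq
      obtain ⟨b, hb⟩ := psi_sep hψ (c := e ^ 2) (d := 1) he2
      obtain ⟨g, hg⟩ := hπ (t (Units.mk0 e he0)⁻¹)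
      obtain ⟨p, hp⟩ := hπ (u b)
      have hgT : g ∈ T := by
        rw [hTdef, Subgroup.mem_comap, hg]; exact t_mem_B _
      have hpP : p ∈ P := by
        rw [hPdef, Subgroup.mem_comap, hp]; exact u_mem _
      have h3 := (h1 hgT).2 p hpP
      have h4 := (h2 hgT).2 p hpP
      rw [ext0_apply _ hpP, ext0_apply _ (hP g hgT p hpP)] at h3 h4
      rw [MonoidHom.mul_apply, MonoidHom.mul_apply, Units.val_mul, Units.val_mul, h3] at h4
      have h5 := mul_left_cancel₀ (Units.ne_zero _) h4
      rw [hκ, hκ] at h5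
      simp only [map_mul, map_inv, hg, hp, t_inv, inv_inv] at h5
      apply hb
      have h6 := t_conj_u (Units.mk0 e he0) b
      rw [t_inv] at h6
      rw [h6] at h5
      simpa using h5
    obtain ⟨V', i1', i2', i3', ρ', hρ', v', hv', hv'μ⟩ := exists_irr_char P μ'
    have hv'W : v' ∈ wtA ρ' P (ext0 P μ') := by
      intro a ha
      rw [ext0_apply μ' ha]; exact hv'μ ⟨a, ha⟩
    have hd := two_level hρ' hT hAP hP (χ' := ext0 P μ') (fun a ha => by
      rw [ext0_apply μ' (hAP ha), ext0_apply l ha, hμ'A]) (fun h => hv' (by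
        rw [h] at hv'W; exact hv'W))
    have hs := hst _ (irr_mem_charDegrees ρ' hρ')
    rw [hd, hTi] at hs
    set k := (stab T P hP (ext0 P μ')).relIndex T with hk
    have hk1 : k ≠ 1 := fun h => hμ's (Subgroup.relIndex_eq_one.1 h)
    have hkd : k ∣ Nat.card F - 1 := by
      have h1 : k ∣ P.relIndex T := Subgroup.relIndex_dvd_of_le_left _ (le_stab hP μ' hPTle)
      have h2 : P.relIndex T * T.index = P.index := Subgroup.relIndex_mul_index hPTle
      have h3 := (U F).card_mul_index
      have hPi : P.index = (U F).index := by rw [hPdef, Subgroup.index_comap_of_surjective _ hπ]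
      rw [hPi, hTi] at h2
      rw [card_U, card_S, ← h2] at h3
      have h6 : P.relIndex T = Nat.card F - 1 := by
        have hpos : 0 < (Nat.card F + 1) * Nat.card F := by positivity
        refine Nat.eq_of_mul_eq_mul_right hpos ?_
        linarith
      rwa [h6] at h1
    have h7 := hs.2.2.resolve_right (hnc _)
    have h8 : k.Coprime (Nat.card F - 1) := h7.of_dvd_left
      (dvd_mul_of_dvd_right (dvd_mul_right _ _) _)
    exact hk1 (Nat.Coprime.eq_one_of_dvd h8 hkd)
  · push Not at hcomm
    obtain ⟨x, y, v, hv, hne⟩ := hcomm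
    obtain ⟨a, ha⟩ := hPmem x x.2
    obtain ⟨b, hb⟩ := hPmem y y.2
    have hxW := hTW x (hPTle x.2)
    have hyW := hTW y (hPTle y.2)
    have hc : (x : N) * (y : N) * ((y : N) * (x : N))⁻¹ ∈ A := by
      rw [← hA, MonoidHom.mem_ker, map_mul, map_inv, map_mul, map_mul, ha, hb, ← u_add, ← u_add,
        add_comm, mul_inv_cancel]
    have hsq : ∀ z : P, (z : N) * z ∈ A := by
      intro z
      obtain ⟨a, ha⟩ := hPmem z z.2
      rw [← hA, MonoidHom.mem_ker, map_mul, ha, ← u_add, CharTwo.add_self_eq_zero, u_zero]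
    obtain ⟨ζ, hζ⟩ : ∃ ζ : ℂ, ∀ w ∈ W, ρ (x : N) (ρ (y : N) w) = ζ • ρ (y : N) (ρ (x : N) w) := by
      refine ⟨ext0 A l ((x : N) * (y : N) * ((y : N) * (x : N))⁻¹), fun w hw => ?_⟩
      have := (hyW _ (hxW w hw)) _ hc
      rw [← this]
      simp only [← Module.End.mul_apply, ← map_mul]
      congr 2
      group
    have hη : ∀ z : P, ∃ η : ℂ, η ≠ 0 ∧ ∀ w ∈ W, ρ (z : N) (ρ (z : N) w) = η • w := by
      intro z
      refine ⟨_, ext0_ne l (hsq z), fun w hw => ?_⟩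
      rw [← hw _ (hsq z), map_mul]; rfl
    obtain ⟨η, hη0, hηx⟩ := hη x
    obtain ⟨η', hη0', hηy⟩ := hη y
    have hζ1 : ζ ≠ 1 := by
      rintro rfl
      apply hne
      rw [hζ v hv, one_smul]
    have hyv : ρ (y : N) v ≠ 0 := by
      intro h
      apply hne
      have h1 : v = 0 := by
        have h2 : ρ (y : N)⁻¹ (ρ (y : N) v) = v := by
          rw [← Module.End.mul_apply, ← map_mul, inv_mul_cancel, map_one, Module.End.one_apply]
        rw [← h2, h, map_zero]
      rw [h1]
      simp only [map_zero]
    have hζ2 : ζ * ζ = 1 := by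
      have h1 := hηx _ (hyW v hv)
      rw [hζ v hv, map_smul, hζ _ (hxW v hv), hηx v hv, map_smul, smul_smul, smul_smul,
        ← sub_eq_zero, ← sub_smul] at h1
      have h2 := (smul_eq_zero.1 h1).resolve_right hyv
      have : (ζ * ζ - 1) * η = 0 := by linear_combination h2
      exact sub_eq_zero.1 ((mul_eq_zero.1 this).resolve_right hη0)
    have hζ3 : ζ = -1 := by
      rcases mul_self_eq_one_iff.1 hζ2 with h | h
      · exact absurd h hζ1
      · exact h
    let X : W →ₗ[ℂ] W := (ρ (x : N)).restrict hxW
    let Y : W →ₗ[ℂ] W := (ρ (y : N)).restrict hyW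
    have hXY : X * Y = (-1 : ℂ) • (Y * X) := by
      ext w
      have := hζ w w.2
      rw [hζ3] at this
      exact this
    have hXX : X * X = η • 1 := by
      ext w
      exact hηx w w.2
    have hYY : Y * Y = η' • 1 := by
      ext w
      exact hηy w w.2
    have hdX : LinearMap.det X ≠ 0 := by
      intro h
      have h1 := congrArg LinearMap.det hXX
      rw [map_mul, h, zero_mul, LinearMap.det_smul, map_one, mul_one] at h1
      exact pow_ne_zero _ hη0 h1.symm
    have hdY : LinearMap.det Y ≠ 0 := by
      intro h
      have h1 := congrArg LinearMap.det hYY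
      rw [map_mul, h, zero_mul, LinearMap.det_smul, map_one, mul_one] at h1
      exact pow_ne_zero _ hη0' h1.symm
    have hev : Even (Module.finrank ℂ W) := by
      have h1 := congrArg LinearMap.det hXY
      rw [LinearMap.det_smul, map_mul, map_mul, mul_comm (LinearMap.det Y)] at h1
      have h2 : (-1 : ℂ) ^ Module.finrank ℂ W = 1 := by
        have h3 : ((-1 : ℂ) ^ Module.finrank ℂ W - 1) * (LinearMap.det X * LinearMap.det Y) = 0 := by
          linear_combination -h1
        exact sub_eq_zero.1 ((mul_eq_zero.1 h3).resolve_right (mul_ne_zero hdX hdY))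
      exact (neg_one_pow_eq_one_iff_even (by norm_num)).1 h2
    have hs := hst _ (irr_mem_charDegrees ρ hρ)
    rw [hdim] at hs
    have h7 := hs.2.1.resolve_right (hnc _)
    have h8 : (2 : ℕ) ∣ 1 := by
      rw [← h7]
      exact Nat.dvd_gcd (dvd_mul_of_dvd_right (even_iff_two_dvd.1 hev) _) (even_iff_two_dvd.1 q1)
    omega

theorem caseA (hq : 4 ≤ Nat.card F) {N : Type} [Group N] [Finite N] (π : N →* SL F)
    (hπ : Function.Surjective π) (hst : ∀ n ∈ charDegrees N, Star (Nat.card F) n)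
    (l : π.ker →* ℂˣ) (hAn : ∀ g ∈ (⊤ : Subgroup N), ∀ a ∈ π.ker, g⁻¹ * a * g ∈ π.ker) :
    stab ⊤ π.ker hAn (ext0 π.ker l) = ⊤ := by
  by_contra hne
  set T := stab ⊤ π.ker hAn (ext0 π.ker l) with hT
  have hker : π.ker ≤ T := le_stab hAn l le_top
  obtain ⟨V, i1, i2, i3, ρ, hρ, v0, hv0, hv0l⟩ := exists_irr_char π.ker l
  have hv0W : v0 ∈ wtA ρ π.ker (ext0 π.ker l) := by
    intro a ha
    rw [ext0_apply l ha]; exact hv0l ⟨a, ha⟩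
  have hdim := irr_dim0 hρ (hA := hAn) _ le_rfl (fun h => hv0 (by
    rw [h] at hv0W; exact hv0W)) (fun g hg v hv => wtA_stab ρ hg hv)
  have hs := hst _ (irr_mem_charDegrees ρ hρ)
  rw [hdim] at hs
  have hs2 := hs.of_dvd (dvd_mul_right _ _)
  rw [← hT, ← Subgroup.index_map_eq _ hπ hker] at hs2
  obtain ⟨s, hs3⟩ := index_star hq (T.map π) (fun h => hne (by
    have := Subgroup.comap_map_eq_self hker
    rw [← this, h, Subgroup.comap_top])) hs2
  let π' : N →* SL F := (MulAut.conj s).toMonoidHom.comp π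
  refine caseA_B hq π' ((MulAut.conj s).surjective.comp hπ) hst π.ker ?_ hAn l ?_
  · ext x
    rw [MonoidHom.mem_ker, MonoidHom.mem_ker]
    exact (MulAut.conj s).map_eq_one_iff
  · rw [← hT, ← hs3, ← Subgroup.comap_comap]
    rw [Subgroup.comap_map_eq_self_of_injective (MulAut.conj s).injective, Subgroup.comap_map_eq_self hker]

end A
end KT

namespace KT
open Matrix
open scoped commutatorElement

theorem transfer_lem {N : Type} [Group N] [Finite N] (hN : commutator N = ⊤) (A : Subgroup N)
    (hA : ∀ x ∈ A, ∀ y ∈ A, x * y = y * x) {z : N} (hz : ∀ g, g * z = z * g)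
    (p : ℕ) [Fact p.Prime] (hzp : orderOf z = p) : p ∣ A.index := by
  letI : CommGroup A := { (inferInstance : Group A) with
    mul_comm := fun x y => Subtype.ext (hA x x.2 y y.2) }
  have key : ∀ (k : ℕ) (g₀ : N), g₀⁻¹ * z ^ k * g₀ = z ^ k := by
    intro k g
    have : Commute g (z ^ k) := (show Commute g z from hz g).pow_right k
    rw [mul_assoc, ← this.eq, ← mul_assoc, inv_mul_cancel, one_mul]
  have h1 := MonoidHom.transfer_eq_pow (MonoidHom.id A) z (fun k g _ => key k g)
  have h2 : MonoidHom.transfer (MonoidHom.id A) z = 1 := by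
    have : commutator N ≤ (MonoidHom.transfer (MonoidHom.id A)).ker :=
      Abelianization.commutator_subset_ker _
    rw [hN] at this
    exact this (Subgroup.mem_top z)
  rw [h2] at h1
  have h3 := congrArg Subtype.val h1
  simp only [MonoidHom.id_apply, Subgroup.coe_one] at h3
  rw [← hzp]
  exact orderOf_dvd_of_pow_eq_one h3.symm

theorem cyc_pre {N S : Type} [Group N] [Group S] (π : N →* S)
    (hc : ∀ a ∈ π.ker, ∀ g, g * a = a * g) (C : Subgroup S) [IsCyclic C] :
    ∀ x ∈ C.comap π, ∀ y ∈ C.comap π, x * y = y * x := by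
  intro x hx y hy
  have := commutative_of_cyclic_center_quotient (π.subgroupComap C) (by
    intro a ha
    rw [Subgroup.mem_center_iff]
    intro g
    apply Subtype.ext
    refine hc a ?_ g
    exact congrArg Subtype.val ha) ⟨x, hx⟩ ⟨y, hy⟩
  exact congrArg Subtype.val this

section F
variable {F : Type} [Field F] [CharP F 2] [Finite F]

theorem split_torus (hq : 4 ≤ Nat.card F) : ∃ C : Subgroup (SL F), IsCyclic C ∧ Nat.card C = Nat.card F - 1 := by
  let τ : Fˣ →* SL F := { toFun := t, map_one' := t_one, map_mul' := fun a b => t_mul a b }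
  have hτ : Function.Injective τ := fun a b h => t_inj h
  refine ⟨τ.range, ?_, ?_⟩
  · exact isCyclic_of_surjective _ τ.rangeRestrict_surjective
  · rw [← Nat.card_congr (MonoidHom.ofInjective hτ).toEquiv, Nat.card_units]

theorem nonsplit_torus (hq : 4 ≤ Nat.card F) : ∃ C : Subgroup (SL F), IsCyclic C ∧ Nat.card F + 1 ∣ Nat.card C := by
  have : Fact (Nat.Prime 2) := ⟨Nat.prime_two⟩
  let E := FiniteField.Extension F 2 2
  have hfr : Module.finrank F E = 2 := FiniteField.finrank_extension F 2 2
  let b : Module.Basis (Fin 2) F E := Module.finBasisOfFinrankEq F E hfr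
  let nm : Eˣ →* Fˣ := Units.map (Algebra.norm F)
  have hdet : ∀ e : nm.ker, (Algebra.leftMulMatrix b ((e : Eˣ) : E)).det = 1 := by
    intro e
    rw [← Algebra.norm_eq_matrix_det]
    exact congrArg Units.val e.2
  let τ : nm.ker →* SL F :=
    { toFun := fun e => ⟨Algebra.leftMulMatrix b ((e : Eˣ) : E), hdet e⟩
      map_one' := by apply Subtype.ext; simp
      map_mul' := by intro x y; apply Subtype.ext; simp; rfl }
  have hτ : Function.Injective τ := by
    intro x y h
    have := Algebra.leftMulMatrix_injective b (congrArg Subtype.val h)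
    exact Subtype.ext (Units.ext this)
  refine ⟨τ.range, isCyclic_of_surjective _ τ.rangeRestrict_surjective, ?_⟩
  rw [← Nat.card_congr (MonoidHom.ofInjective hτ).toEquiv]
  have h1 := nm.ker.card_mul_index
  rw [Subgroup.index_ker, Nat.card_units, FiniteField.natCard_extension] at h1
  have h2 : Nat.card nm.range ∣ Nat.card Fˣ := Subgroup.card_subgroup_dvd_card _
  rw [Nat.card_units] at h2
  obtain ⟨k, hk⟩ := h2
  have h3 : Nat.card F ^ 2 - 1 = (Nat.card F + 1) * (Nat.card F - 1) := by
    have := Nat.sq_sub_sq (Nat.card F) 1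
    simpa using this
  rw [h3, hk] at h1
  have h4 : 0 < Nat.card nm.range := Nat.card_pos
  refine ⟨k, ?_⟩
  refine Nat.eq_of_mul_eq_mul_right h4 ?_
  rw [h1]; ring

theorem odd_case (hq : 4 ≤ Nat.card F) {N : Type} [Group N] [Finite N] (hN : commutator N = ⊤)
    (π : N →* SL F) (hπ : Function.Surjective π) (hc : ∀ a ∈ π.ker, ∀ g, g * a = a * g)
    (p : ℕ) [hp : Fact p.Prime] {z : N} (hz : z ∈ π.ker) (hzp : orderOf z = p) : p = 2 := by
  by_contra hp2
  have key : ∀ C : Subgroup (SL F), IsCyclic C → p ∣ C.index := by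
    intro C hC
    rw [← Subgroup.index_comap_of_surjective _ hπ]
    exact transfer_lem hN _ (cyc_pre π hc C) (hc z hz) p hzp
  have hpq : p.Coprime (Nat.card F) := by
    obtain ⟨f, hf, hF⟩ := q_pow hq
    rw [hF]
    exact (((Nat.coprime_primes hp.1 Nat.prime_two).2 hp2)).pow_right _
  have h0 := (key ⊥ inferInstance)
  rw [Subgroup.index_bot, card_S] at h0
  have hnd : ∀ {m}, p ∣ m → p.Coprime m → False := fun h1 h2 => by
    have := Nat.Coprime.eq_one_of_dvd h2 h1
    exact hp.1.one_lt.ne' this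
  rcases hp.1.dvd_mul.1 h0 with h | h
  · obtain ⟨C, hC, hd⟩ := nonsplit_torus hq
    have h1 := key C hC
    have h2 := C.card_mul_index
    obtain ⟨k, hk⟩ := hd
    rw [card_S, hk, mul_assoc] at h2
    have h3 := Nat.eq_of_mul_eq_mul_left (by omega) h2
    have h4 : p ∣ (Nat.card F - 1) * Nat.card F := h3 ▸ dvd_mul_of_dvd_right h1 _
    rcases hp.1.dvd_mul.1 h4 with h5 | h5
    · exact hnd h ((cop3 hq).of_dvd_left h5)
    · exact hnd h5 hpq
  · have h' := (hp.1.dvd_mul.1 h).resolve_right (fun h => hnd h hpq)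
    obtain ⟨C, hC, hd⟩ := split_torus hq
    have h1 := key C hC
    have h2 := C.card_mul_index
    rw [card_S, hd, mul_left_comm] at h2
    have h3 := Nat.eq_of_mul_eq_mul_left (by omega) h2
    rw [h3] at h1
    rcases hp.1.dvd_mul.1 h1 with h5 | h5
    · exact hnd h5 ((cop3 hq).of_dvd_left h')
    · exact hnd h5 hpq

end F
end KT

namespace KT
open Matrix
open scoped commutatorElement

section F
variable {F : Type} [Field F] [CharP F 2] [Finite F]

/-- nontrivial involution -/
def Inv2 {S : Type} [Group S] (s : S) : Prop := s * s = 1 ∧ s ≠ 1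

theorem Inv2.conj {S : Type} [Group S] {s : S} (h : Inv2 s) (g : S) : Inv2 (g * s * g⁻¹) := by
  constructor
  · have : g * s * g⁻¹ * (g * s * g⁻¹) = g * (s * s) * g⁻¹ := by group
    rw [this, h.1, mul_one, mul_inv_cancel]
  · intro h'
    exact h.2 (by rwa [mul_inv_eq_one, mul_eq_left] at h')

omit [Finite F] in
theorem inv2_u {b : F} (hb : b ≠ 0) : Inv2 (u b) := by
  constructor
  · rw [← u_add, CharTwo.add_self_eq_zero, u_zero]
  · rw [← u_zero]; exact fun h => hb (u_inj h)

theorem Inv2.to_u {s : SL F} (h : Inv2 s) (hq : 4 ≤ Nat.card F) : ∃ w b, b ≠ 0 ∧ w * s * w⁻¹ = u b := by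
  obtain ⟨f, hf, hF⟩ := q_pow hq
  have : Fact (Nat.Prime 2) := ⟨Nat.prime_two⟩
  have h1 : IsPGroup 2 (Subgroup.zpowers s) := by
    apply IsPGroup.of_card (n := 1)
    rw [Nat.card_zpowers]
    rw [pow_one]
    exact orderOf_eq_prime (by rw [pow_two, h.1]) h.2
  obtain ⟨P, hP⟩ := h1.exists_le_sylow
  have hPc : Nat.card P = Nat.card F := by
    rw [Sylow.card_eq_multiplicity]
    obtain ⟨q1, q2, q3⟩ := odd_pm hq
    have e1 : (Nat.card F).factorization 2 = f := by
      rw [hF, Nat.Prime.factorization_pow Nat.prime_two]; simp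
    rw [card_S, Nat.factorization_mul (by omega) (Nat.mul_ne_zero (by omega) (by omega)),
      Nat.factorization_mul (by omega) (by omega)]
    simp only [Finsupp.add_apply, e1]
    rw [Nat.factorization_eq_zero_of_not_dvd q3.not_two_dvd_nat,
      Nat.factorization_eq_zero_of_not_dvd q2.not_two_dvd_nat, hF]
    simp
  obtain ⟨w, hw⟩ := sylow_conj hq P hPc
  have h2 : w * s * w⁻¹ ∈ U F := by
    rw [← hw]
    exact ⟨s, hP (Subgroup.mem_zpowers s), rfl⟩
  obtain ⟨b, hb⟩ := h2
  refine ⟨w, b, ?_, hb.symm⟩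
  rintro rfl
  have := h.conj w
  rw [← hb, u_zero] at this
  exact this.2 rfl

theorem Inv2.is_conj {s s' : SL F} (h : Inv2 s) (h' : Inv2 s') (hq : 4 ≤ Nat.card F) :
    ∃ w, w * s * w⁻¹ = s' := by
  obtain ⟨w, b, hb, hw⟩ := h.to_u hq
  obtain ⟨w', b', hb', hw'⟩ := h'.to_u hq
  obtain ⟨a, ha⟩ := t_trans hb hb'
  refine ⟨w'⁻¹ * t a * w, ?_⟩
  have : w'⁻¹ * t a * w * s * (w'⁻¹ * t a * w)⁻¹ = w'⁻¹ * (t a * (w * s * w⁻¹) * (t a)⁻¹) * w' := by group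
  rw [this, hw, ha, ← hw']; group

/-- setup -/
structure DC (F : Type) [Field F] (N : Type) [Group N] (π : N →* SL F) (z : N) : Prop where
  perf : commutator N = ⊤
  surj : Function.Surjective π
  ker : ∀ a, π a = 1 ↔ a = 1 ∨ a = z
  z1 : z ≠ 1
  zc : ∀ g, g * z = z * g

variable {N : Type} [Group N] {π : N →* SL F} {z : N}

omit [CharP F 2] [Finite F] in
theorem DC.piz (h : DC F N π z) : π z = 1 := (h.ker z).2 (Or.inr rfl)

omit [CharP F 2] [Finite F] in
theorem DC.zz (h : DC F N π z) : z * z = 1 := by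
  rcases (h.ker (z * z)).1 (by rw [map_mul, h.piz, one_mul]) with h1 | h1
  · exact h1
  · exact absurd (mul_eq_left.1 h1) h.z1

omit [CharP F 2] [Finite F] in
theorem DC.eq_or (h : DC F N π z) {x y : N} (hxy : π x = π y) : x = y ∨ x = z * y := by
  rcases (h.ker (x * y⁻¹)).1 (by rw [map_mul, map_inv, hxy, mul_inv_cancel]) with h1 | h1
  · left; exact mul_inv_eq_one.1 h1
  · right; exact mul_inv_eq_iff_eq_mul.1 h1

theorem DC.sq_eq (h : DC F N π z) (hq : 4 ≤ Nat.card F) {x y : N} (hx : Inv2 (π x))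
    (hy : Inv2 (π y)) : x * x = y * y := by
  obtain ⟨w, hw⟩ := hx.is_conj hy hq
  obtain ⟨g, rfl⟩ := h.surj w
  have h0 : ∀ a, π a = 1 → ∀ g, g * a = a * g := by
    intro a ha g
    rcases (h.ker a).1 ha with rfl | rfl
    · simp
    · exact h.zc g
  have h1 : g * (x * x) * g⁻¹ = x * x := by
    rw [h0 (x * x) (by rw [map_mul, hx.1]) g, mul_inv_cancel_right]
  have h2 : g * (x * x) * g⁻¹ = (g * x * g⁻¹) * (g * x * g⁻¹) := by group
  rw [← h1, h2]
  rw [← map_inv, ← map_mul, ← map_mul] at hw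
  rcases h.eq_or hw with e | e
  · rw [e]
  · rw [e]
    have : z * y * (z * y) = (z * z) * (y * y) := by
      rw [mul_assoc, ← mul_assoc y z y, h.zc y]; group
    rw [this, h.zz, one_mul]

theorem DC.sq_z [Finite N] (h : DC F N π z) (hq : 4 ≤ Nat.card F) {x : N} (hx : Inv2 (π x)) : x * x = z := by
  by_contra hne
  have hx1 : x * x = 1 := by
    rcases (h.ker (x * x)).1 (by rw [map_mul, hx.1]) with h1 | h1
    · exact h1
    · exact absurd h1 hne
  have hall : ∀ y ∈ (U F).comap π, y * y = 1 := by
    intro y hy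
    obtain ⟨b, hb⟩ := hy
    by_cases hb0 : b = 0
    · rw [hb0, u_zero] at hb
      rcases (h.ker y).1 hb.symm with rfl | rfl
      · simp
      · exact h.zz
    · rw [h.sq_eq hq (x := y) (y := x) (by rw [← hb]; exact inv2_u hb0) hx, hx1]
  have hcomm : ∀ a ∈ (U F).comap π, ∀ b ∈ (U F).comap π, a * b = b * a := by
    intro a ha b hb
    have h1 := hall _ (mul_mem ha hb)
    have ha1 := eq_inv_of_mul_eq_one_left (hall a ha)
    have hb1 := eq_inv_of_mul_eq_one_left (hall b hb)
    have h2 := eq_inv_of_mul_eq_one_left h1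
    rw [h2, _root_.mul_inv_rev, ← ha1, ← hb1]
  have : Fact (Nat.Prime 2) := ⟨Nat.prime_two⟩
  have h2 := transfer_lem h.perf _ hcomm h.zc 2 (orderOf_eq_prime (by rw [pow_two, h.zz]) h.z1)
  rw [Subgroup.index_comap_of_surjective _ h.surj] at h2
  have h3 := (U F).card_mul_index
  rw [card_U, card_S] at h3
  have h4 : (U F).index = (Nat.card F + 1) * (Nat.card F - 1) := by
    refine Nat.eq_of_mul_eq_mul_left (show 0 < Nat.card F by omega) ?_
    rw [h3]; ring
  obtain ⟨q1, q2, q3⟩ := odd_pm hq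
  rw [h4] at h2
  exact (q3.mul q2).not_two_dvd_nat h2

theorem DC.anti [Finite N] (h : DC F N π z) (hq : 4 ≤ Nat.card F) {x y : N} (hx : Inv2 (π x))
    (hy : Inv2 (π y)) (hxy : Inv2 (π (x * y))) : x * y = z * (y * x) := by
  have h1 := h.sq_z hq hx
  have h2 := h.sq_z hq hy
  have h3 := h.sq_z hq hxy
  have h4 : x * y * (x * y) * (y * x) = z * (y * x) := by rw [h3]
  have h5 : x * y * (x * y) * (y * x) = x * y * x * (y * y) * x := by group
  rw [h5, h2, mul_assoc (x * y * x), ← h.zc x] at h4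
  have h6 : x * y * x * (x * z) = x * y * (x * x) * z := by group
  rw [h6, h1, mul_assoc, h.zz, mul_one] at h4
  exact h4

theorem DC.q_eq [Finite N] (h : DC F N π z) (hq : 4 ≤ Nat.card F) : Nat.card F = 4 := by
  by_contra hne
  have := Fintype.ofFinite F
  classical
  rw [Nat.card_eq_fintype_card] at hne
  have hq' := hq
  rw [Nat.card_eq_fintype_card] at hq'
  obtain ⟨b, hb⟩ : ∃ b : F, b ∉ ({0, 1} : Finset F) := by
    by_contra hcon
    push Not at hcon
    have := Finset.card_le_two (a := (0:F)) (b := 1)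
    rw [(Finset.eq_univ_iff_forall.2 hcon), Finset.card_univ] at this
    omega
  obtain ⟨c, hc⟩ : ∃ c : F, c ∉ ({0, 1, b, 1 + b} : Finset F) := by
    by_contra hcon
    push Not at hcon
    have := Finset.card_le_four (a := (0:F)) (b := 1) (c := b) (d := 1 + b)
    rw [(Finset.eq_univ_iff_forall.2 hcon), Finset.card_univ] at this
    omega
  simp only [Finset.mem_insert, Finset.mem_singleton, not_or] at hb hc
  obtain ⟨x, hx⟩ := h.surj (u 1)
  obtain ⟨y, hy⟩ := h.surj (u b)
  obtain ⟨w, hw⟩ := h.surj (u c)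
  have hadd : ∀ a b : F, a + b = 0 ↔ a = b := fun a b => CharTwo.add_eq_zero
  have i1 : Inv2 (π x) := hx ▸ inv2_u one_ne_zero
  have i2 : Inv2 (π y) := hy ▸ inv2_u hb.1
  have i3 : Inv2 (π w) := hw ▸ inv2_u hc.1
  have i4 : Inv2 (π (x * y)) := by
    rw [map_mul, hx, hy, ← u_add]; exact inv2_u (fun h => hb.2 ((hadd _ _).1 h).symm)
  have i5 : Inv2 (π (x * w)) := by
    rw [map_mul, hx, hw, ← u_add]; exact inv2_u (fun h => hc.2.1 ((hadd _ _).1 h).symm)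
  have i6 : Inv2 (π (y * w)) := by
    rw [map_mul, hy, hw, ← u_add]; exact inv2_u (fun h => hc.2.2.1 ((hadd _ _).1 h).symm)
  have i7 : Inv2 (π (x * (y * w))) := by
    rw [map_mul, map_mul, hx, hy, hw, ← u_add, ← u_add]; exact inv2_u (fun h => hc.2.2.2 (by
      rw [← add_assoc] at h
      exact ((hadd _ _).1 h).symm))
  have e1 := h.anti hq i1 i2 i4
  have e2 := h.anti hq i1 i3 i5
  have e3 := h.anti hq i1 i6 i7
  have e4 : x * (y * w) = y * w * x := by
    rw [← mul_assoc, e1]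
    have : z * (y * x) * w = z * (y * (x * w)) := by group
    rw [this, e2, ← mul_assoc y, h.zc y]
    have : z * (z * y * (w * x)) = (z * z) * (y * w * x) := by group
    rw [this, h.zz, one_mul]
  rw [e4] at e3
  exact h.z1 (mul_eq_right.1 e3.symm)

end F
end KT

namespace KT
open Matrix
open scoped commutatorElement

theorem mono_dim {Γ V : Type} [Group Γ] [Finite Γ] [AddCommGroup V] [Module ℂ V]
    [FiniteDimensional ℂ V] {ρ : Representation ℂ Γ V} (hρ : Irr ρ) (H : Subgroup Γ) (α : H →* ℂˣ)
    {v : V} (hv : v ≠ 0) (hα : ∀ h : H, ρ (h : Γ) v = (α h : ℂ) • v)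
    (hmac : ∀ g, g ∉ H → ∃ (t : Γ) (h1 : t ∈ H) (h2 : g⁻¹ * t * g ∈ H), α ⟨_, h2⟩ ≠ α ⟨t, h1⟩) :
    Module.finrank ℂ V = H.index := by
  classical
  have := Fintype.ofFinite Γ
  have := Fintype.ofFinite H
  have := Fintype.ofFinite (Γ ⧸ H)
  have hmul : ∀ (x y : Γ) (w : V), ρ (x * y) w = ρ x (ρ y w) := fun x y w => by
    rw [map_mul]; rfl
  let e : V →ₗ[ℂ] V := ∑ h : H, ((α h)⁻¹ : ℂˣ).val • ρ (h : Γ)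
  have he1 : e v = (Fintype.card H : ℂ) • v := by
    simp only [e, LinearMap.sum_apply, LinearMap.smul_apply, hα, smul_smul, Units.inv_mul, one_smul,
      Finset.sum_const, Finset.card_univ]
    rw [Nat.cast_smul_eq_nsmul]
  have he2 : ∀ (t : H) (w : V), e (ρ (t : Γ) w) = (α t : ℂ) • e w := by
    intro t w
    simp only [e, LinearMap.sum_apply, LinearMap.smul_apply, Finset.smul_sum]
    refine Fintype.sum_equiv (Equiv.mulRight t) _ _ (fun h => ?_)
    change ((α h)⁻¹ : ℂˣ).val • ρ (h : Γ) (ρ (t : Γ) w) =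
      (α t : ℂ) • ((α (h * t))⁻¹ : ℂˣ).val • ρ ((h : Γ) * (t : Γ)) w
    rw [hmul, smul_smul, map_mul α, _root_.mul_inv_rev, Units.val_mul, ← mul_assoc,
      Units.mul_inv, one_mul]
  have he3 : ∀ g, g ∉ H → e (ρ g v) = 0 := by
    intro g hg
    obtain ⟨t, h1, h2, hne⟩ := hmac g hg
    have h3 := he2 ⟨t, h1⟩ (ρ g v)
    have h4 : ρ t (ρ g v) = (α ⟨_, h2⟩ : ℂ) • ρ g v := by
      rw [← map_smul, ← hα ⟨_, h2⟩, ← hmul, ← hmul]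
      congr 2
      group
    simp only at h3
    rw [h4, map_smul, ← sub_eq_zero, ← sub_smul] at h3
    rcases smul_eq_zero.1 h3 with h5 | h5
    · exact absurd (Units.ext (sub_eq_zero.1 h5)) hne
    · exact h5
  let f : Γ ⧸ H → V := fun x => ρ x.out v
  have hli : LinearIndependent ℂ f := by
    rw [Fintype.linearIndependent_iff]
    intro c hc i
    have h1 := congrArg (fun w => e (ρ i.out⁻¹ w)) hc
    simp only [map_sum, map_smul, map_zero, f, ← hmul] at h1
    rw [Finset.sum_eq_single i] at h1
    · rw [inv_mul_cancel, map_one, Module.End.one_apply, he1, smul_smul] at h1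
      have h2 := (smul_eq_zero.1 h1).resolve_right hv
      refine (mul_eq_zero.1 h2).resolve_right ?_
      exact Nat.cast_ne_zero.2 Fintype.card_ne_zero
    · intro j _ hj
      rw [he3, smul_zero]
      intro hm
      apply hj
      have := QuotientGroup.eq.2 hm
      simpa using this.symm
    · simp
  have hsp : ⊤ ≤ Submodule.span ℂ (Set.range f) := by
    rw [← orbit_span hρ hv, Submodule.span_le]
    rintro _ ⟨x, rfl⟩
    obtain ⟨h, hh⟩ := QuotientGroup.mk_out_eq_mul H x
    have h1 : ρ x v = ((α h)⁻¹ : ℂˣ).val • f (x : Γ ⧸ H) := by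
      simp only [f]
      rw [hh, hmul, hα, map_smul, smul_smul, Units.inv_mul, one_smul]
    change ρ x v ∈ _
    rw [h1]
    exact Submodule.smul_mem _ _ (Submodule.subset_span ⟨_, rfl⟩)
  rw [Module.finrank_eq_card_basis (Module.Basis.mk hli hsp), Subgroup.index, Nat.card_eq_fintype_card]

end KT

namespace KT
open Matrix
open scoped commutatorElement

theorem char_sep {A : Type} [Group A] [Finite A] (hA : ∀ x y : A, x * y = y * x) {a : A} (ha : a ≠ 1) :
    ∃ χ : A →* ℂˣ, χ a ≠ 1 := by
  letI : CommGroup A := { (inferInstance : Group A) with mul_comm := hA }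
  have : NeZero (Monoid.exponent A) := ⟨Monoid.exponent_ne_zero_of_finite⟩
  exact CommGroup.exists_apply_ne_one_of_hasEnoughRootsOfUnity A ℂ ha

section F
variable {F : Type} [Field F] [CharP F 2] [Finite F]
variable {N : Type} [Group N] {π : N →* SL F} {z : N}

theorem DC.card [Finite N] (h : DC F N π z) (hq4 : Nat.card F = 4) : Nat.card N = 120 := by
  have h1 := π.ker.card_mul_index
  have h2 : π.ker = Subgroup.zpowers z := by
    apply le_antisymm
    · intro x hx
      rcases (h.ker x).1 hx with rfl | rfl
      · exact one_mem _
      · exact Subgroup.mem_zpowers _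
    · rw [Subgroup.zpowers_le]; exact h.piz
  have : Fact (Nat.Prime 2) := ⟨Nat.prime_two⟩
  have h3 : orderOf z = 2 := orderOf_eq_prime (by rw [pow_two, h.zz]) h.z1
  rw [Subgroup.index_ker, h2, Nat.card_zpowers, h3, MonoidHom.range_eq_top.2 h.surj,
    Subgroup.card_top, card_S, hq4] at h1
  omega

theorem DC.cent [Finite N] (h : DC F N π z) (hq : 4 ≤ Nat.card F) {x g : N} (hx : Inv2 (π x))
    (hg : g * x = x * g) : g = 1 ∨ g = z ∨ g * x = 1 ∨ g * x = z := by
  by_contra hcon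
  push Not at hcon
  obtain ⟨c1, c2, c3, c4⟩ := hcon
  obtain ⟨w, b, hb, hw⟩ := hx.to_u hq
  have key : ∀ y, y * x = x * y → π y = 1 ∨ Inv2 (π y) := by
    intro y hy
    have hU : w * π y * w⁻¹ ∈ U F := by
      apply cent_u2 hb
      rw [← hw]
      have e1 : w * π y * w⁻¹ * (w * π x * w⁻¹) = w * (π (y * x)) * w⁻¹ := by
        rw [map_mul]; group
      have e2 : (w * π x * w⁻¹) * (w * π y * w⁻¹) = w * (π (x * y)) * w⁻¹ := by
        rw [map_mul]; group
      rw [e1, e2, hy]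
    obtain ⟨c, hc⟩ := hU
    have hy2 : π y = w⁻¹ * u c * w := by rw [hc]; group
    by_cases hc0 : c = 0
    · left; rw [hy2, hc0, u_zero]; group
    · right
      rw [hy2]
      have := (inv2_u hc0).conj w⁻¹
      rwa [inv_inv] at this
  have i1 := (key g hg).resolve_left (fun h' => by
    rcases (h.ker g).1 h' with e | e
    · exact c1 e
    · exact c2 e)
  have i2 := (key (g * x) (by rw [hg, mul_assoc, hg])).resolve_left (fun h' => by
    rcases (h.ker _).1 h' with e | e
    · exact c3 e
    · exact c4 e)
  have := h.anti hq i1 hx i2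
  rw [hg] at this
  exact h.z1 (mul_eq_right.1 this.symm)

set_option maxHeartbeats 1000000 in
theorem DC.q4 [Finite N] (h : DC F N π z) (hq4 : Nat.card F = 4) : 6 ∈ charDegrees N := by
  have hq : 4 ≤ Nat.card F := hq4.ge
  have : Fact (Nat.Prime 2) := ⟨Nat.prime_two⟩
  have : Fact (Nat.Prime 5) := ⟨Nat.prime_five⟩
  have hN := h.card hq4
  have hS : Nat.card (SL F) = 60 := by rw [card_S, hq4]
  obtain ⟨Q⟩ : Nonempty (Sylow 5 N) := inferInstance
  have hQ : Nat.card Q = 5 := by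
    rw [Sylow.card_eq_multiplicity, hN]
    have : (120 : ℕ) = 5 * 24 := rfl
    rw [this, Nat.factorization_mul (by norm_num) (by norm_num), Finsupp.add_apply,
      Nat.Prime.factorization_self Nat.prime_five,
      Nat.factorization_eq_zero_of_not_dvd (by norm_num), add_zero, pow_one]
  have hQi : (Q : Subgroup N).index = 24 := by
    have h1 := (Q : Subgroup N).card_mul_index
    have h2 : Nat.card (Q : Subgroup N) = 5 := hQ
    rw [h2, hN] at h1
    omega
  set H : Subgroup N := Subgroup.normalizer ((Q : Subgroup N) : Set N) with hH
  have hHi : H.index = 6 := by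
    have h1 := Q.card_eq_index_normalizer
    have h2 := Q.card_dvd_index
    have h3 := card_sylow_modEq_one 5 N
    rw [h1] at h2 h3
    change H.index ∣ _ at h2
    change H.index % 5 = 1 % 5 at h3
    rw [hQi] at h2
    have h4 : H.index ≤ 24 := Nat.le_of_dvd (by norm_num) h2
    have h5 : H.index ≠ 1 := by
      intro h6
      have h7 : H = ⊤ := Subgroup.index_eq_one.1 h6
      have : (Q : Subgroup N).Normal := Subgroup.normalizer_eq_top_iff.1 h7
      have hm : ((Q : Subgroup N).map π).Normal := this.map π h.surj
      have hd : Nat.card ((Q : Subgroup N).map π) ∣ 5 := by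
        have h8 : Nat.card ((Q : Subgroup N).map π) ∣ Nat.card (Q : Subgroup N) := Subgroup.card_map_dvd _ π
        have h9 : Nat.card (Q : Subgroup N) = 5 := hQ
        rwa [h9] at h8
      rcases (simple_S hq).eq_bot_or_eq_top_of_normal _ hm with e | e
      · rw [Subgroup.map_eq_bot_iff] at e
        have h8 : Nat.card (Q : Subgroup N) ∣ Nat.card π.ker := Subgroup.card_dvd_of_le e
        have h9 := π.ker.card_mul_index
        rw [Subgroup.index_ker, MonoidHom.range_eq_top.2 h.surj, Subgroup.card_top, hS, hN] at h9
        have : Nat.card (Q : Subgroup N) = 5 := hQ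
        have h10 : Nat.card π.ker = 2 := by omega
        rw [this, h10] at h8
        omega
      · rw [e, Subgroup.card_top, hS] at hd
        omega
    interval_cases H.index <;> omega
  have hHc : Nat.card H = 20 := by
    have h1 := H.card_mul_index
    rw [hHi, hN] at h1
    omega
  have hzH : z ∈ H := by
    rw [hH, Subgroup.mem_normalizer_iff]
    intro x
    rw [← h.zc x, mul_inv_cancel_right]
  -- the character
  set Qh : Subgroup H := (Q : Subgroup N).subgroupOf H with hQh
  have hQn : Qh.Normal := Subgroup.normal_in_normalizer
  have hQhc : Nat.card Qh = 5 := by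
    rw [hQh, Nat.card_congr (Subgroup.subgroupOfEquivOfLe Subgroup.le_normalizer).toEquiv]
    exact hQ
  have hc4 : Nat.card (H ⧸ Qh) = 2 ^ 2 := by
    have h1 := Qh.card_mul_index
    rw [hQhc, hHc] at h1
    change Qh.index = _
    omega
  have hzQ : (z : N) ∉ (Q : Subgroup N) := by
    intro hz
    have h1 : orderOf (⟨z, hz⟩ : Q) ∣ Nat.card Q := orderOf_dvd_natCard _
    have h2 : orderOf (⟨z, hz⟩ : Q) ∣ 2 := orderOf_dvd_of_pow_eq_one (by
      apply Subtype.ext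
      change z ^ 2 = 1
      rw [pow_two, h.zz])
    rw [hQ] at h1
    have h3 := Nat.dvd_gcd h1 h2
    norm_num at h3
    exact h.z1 (congrArg Subtype.val h3)
  obtain ⟨χ, hχ⟩ := char_sep (IsPGroup.commutative_of_card_eq_prime_sq hc4)
    (a := ((⟨z, hzH⟩ : H) : H ⧸ Qh)) (by
      intro h1
      exact hzQ ((QuotientGroup.eq_one_iff (N := Qh) (⟨z, hzH⟩ : H)).1 h1))
  set α : H →* ℂˣ := χ.comp (QuotientGroup.mk' Qh) with hα
  have hαz : α ⟨z, hzH⟩ ≠ 1 := hχ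
  have hzz : (⟨z, hzH⟩ : H) * ⟨z, hzH⟩ = 1 := Subtype.ext h.zz
  obtain ⟨V, i1, i2, i3, ρ, hρ, v, hv, hvα⟩ := exists_irr_char H α
  have hdim := mono_dim hρ H α hv hvα (by
    intro g hg
    -- the intersection
    set H' : Subgroup N := H.comap (MulAut.conj g⁻¹).toMonoidHom with hH'
    have hH'm : ∀ x, x ∈ H' ↔ g⁻¹ * x * g ∈ H := by
      intro x
      rw [hH', Subgroup.mem_comap]
      simp
    have hH'i : H'.index = 6 := by
      rw [hH', Subgroup.index_comap_of_surjective _ (MulAut.conj g⁻¹).surjective, hHi]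
    set J := H ⊓ H' with hJ
    have hJc : Nat.card J = 4 := by
      have h1 := J.card_mul_index
      have h2 : J.index ≤ H.index * H'.index := Subgroup.index_inf_le
      rw [hHi, hH'i] at h2
      rw [hN] at h1
      have h3 : Nat.card J ∣ 20 := by rw [← hHc]; exact Subgroup.card_dvd_of_le inf_le_left
      have h4 : ¬ 5 ∣ Nat.card J := by
        intro h5
        obtain ⟨x, hx⟩ := exists_prime_orderOf_dvd_card' 5 h5
        have hx5 : (x : N) ^ 5 = 1 := by
          have := pow_orderOf_eq_one x
          rw [hx] at this
          exact congrArg Subtype.val this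
        have hx1 : (x : N) ≠ 1 := by
          intro h6
          have : x = 1 := Subtype.ext h6
          rw [this, orderOf_one] at hx
          omega
        have hmem : ∀ y ∈ H, y ^ 5 = 1 → y ∈ (Q : Subgroup N) := by
          intro y hy hy5
          have h1 : (((⟨y, hy⟩ : H) : H ⧸ Qh)) ^ 4 = 1 := by
            have := pow_card_eq_one' (x := ((⟨y, hy⟩ : H) : H ⧸ Qh))
            rw [hc4] at this
            exact this
          have h2 : (((⟨y, hy⟩ : H) : H ⧸ Qh)) ^ 5 = 1 := by
            rw [← QuotientGroup.mk_pow]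
            have : (⟨y, hy⟩ : H) ^ 5 = 1 := Subtype.ext hy5
            rw [this]; rfl
          rw [pow_succ, h1, one_mul] at h2
          exact (QuotientGroup.eq_one_iff (N := Qh) (⟨y, hy⟩ : H)).1 h2
        have hxQ := hmem x x.2.1 hx5
        have hxQ' := hmem _ ((hH'm _).1 x.2.2) (by
          have : (g⁻¹ * (x : N) * g) ^ 5 = g⁻¹ * (x : N) ^ 5 * g := by
            have := conj_pow (i := 5) (a := g⁻¹) (b := (x : N))
            rwa [inv_inv] at this
          rw [this, hx5]; group)
        have hzp : Subgroup.zpowers (x : N) = (Q : Subgroup N) := by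
          apply Subgroup.eq_of_le_of_card_ge
          · rwa [Subgroup.zpowers_le]
          · rw [Nat.card_zpowers, orderOf_eq_prime hx5 hx1]; exact hQ.le
        apply hg
        have hinc : ∀ y ∈ (Q : Subgroup N), g⁻¹ * y * g ∈ (Q : Subgroup N) := by
          intro y hy
          rw [← hzp] at hy
          obtain ⟨k, rfl⟩ := hy
          have : g⁻¹ * (x : N) ^ k * g = (g⁻¹ * (x : N) * g) ^ k := by
            have := conj_zpow (i := k) (a := g⁻¹) (b := (x : N))
            rw [inv_inv] at this
            exact this.symm
          rw [this]
          exact zpow_mem hxQ' k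
        have hle : (Q : Subgroup N).map (MulAut.conj g⁻¹).toMonoidHom ≤ (Q : Subgroup N) := by
          rintro _ ⟨y, hy, rfl⟩
          have := hinc y hy
          simpa using this
        have heq := Subgroup.eq_of_le_of_card_ge hle (by
          rw [Subgroup.card_map_of_injective (MulAut.conj g⁻¹).injective])
        have : g⁻¹ ∈ H := by
          rw [hH, Subgroup.mem_normalizer_iff_map_conj_eq]
          exact heq
        simpa using this
      have h5 : Nat.card J ≤ 20 := Nat.le_of_dvd (by norm_num) h3
      have h6 : 4 ≤ Nat.card J := by
        by_contra h7
        nlinarith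
      interval_cases Nat.card J <;> omega
    have hzJ : z ∈ J := ⟨hzH, (hH'm z).2 (by rw [mul_assoc, ← h.zc g, ← mul_assoc, inv_mul_cancel, one_mul]; exact hzH)⟩
    classical
    obtain ⟨t, htJ, ht⟩ : ∃ t ∈ J, t ∉ ({1, z} : Finset N) := by
      by_contra hcon
      push Not at hcon
      have h1 : (J : Set N) ⊆ (({1, z} : Finset N) : Set N) := fun x hx => hcon x hx
      have h2 := Set.ncard_le_ncard h1 (Finset.finite_toSet _)
      rw [Set.ncard_coe_finset] at h2
      have h3 := Finset.card_le_two (a := (1:N)) (b := z)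
      have h4 : (J : Set N).ncard = 4 := hJc
      omega
    simp only [Finset.mem_insert, Finset.mem_singleton, not_or] at ht
    have hJset : (({1, z, t, t * z} : Finset N) : Set N) = (J : Set N) := by
      apply Set.eq_of_subset_of_ncard_le
      · intro x hx
        simp only [Finset.coe_insert, Finset.coe_singleton, Set.mem_insert_iff,
          Set.mem_singleton_iff] at hx
        rcases hx with rfl | rfl | rfl | rfl
        · exact J.one_mem
        · exact hzJ
        · exact htJ
        · exact J.mul_mem htJ hzJ
      · rw [Set.ncard_coe_finset, Finset.card_eq_of_equiv_fin (n := 4)]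
        · exact hJc.le
        · refine (Finset.equivFinOfCardEq ?_)
          have n1 : t * z ≠ 1 := fun e => ht.2 (by
            rw [eq_inv_of_mul_eq_one_left e]
            exact (eq_inv_of_mul_eq_one_left h.zz).symm)
          rw [Finset.card_insert_of_notMem, Finset.card_insert_of_notMem, Finset.card_insert_of_notMem,
            Finset.card_singleton]
          · simp only [Finset.mem_singleton]
            exact fun e => h.z1 (mul_eq_left.1 e.symm)
          · simp only [Finset.mem_insert, Finset.mem_singleton, not_or]
            exact ⟨fun e => ht.2 e.symm, fun e => ht.1 (mul_eq_right.1 e.symm)⟩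
          · simp only [Finset.mem_insert, Finset.mem_singleton, not_or]
            exact ⟨fun e => h.z1 e.symm, fun e => ht.1 e.symm, fun e => n1 e.symm⟩
      · exact Set.toFinite _
    have htt : t * t = 1 ∨ t * t = z := by
      have h1 : t * t ∈ (J : Set N) := J.mul_mem htJ htJ
      rw [← hJset] at h1
      simp only [Finset.coe_insert, Finset.coe_singleton, Set.mem_insert_iff,
          Set.mem_singleton_iff] at h1
      rcases h1 with e | e | e | e
      · exact Or.inl e
      · exact Or.inr e
      · exact absurd (mul_eq_left.1 e) ht.1
      · exact absurd (mul_left_cancel e) ht.2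
    have hinv : Inv2 (π t) := by
      constructor
      · rw [← map_mul]; exact (h.ker _).2 htt
      · intro h1
        rcases (h.ker _).1 h1 with e | e
        · exact ht.1 e
        · exact ht.2 e
    have htz := h.sq_z hq hinv
    refine ⟨t, htJ.1, (hH'm t).1 htJ.2, ?_⟩
    intro heq
    set t' := g⁻¹ * t * g with ht'
    have ht'H : t' ∈ H := (hH'm t).1 htJ.2
    have ht'z : t' * t' = z := by
      have : t' * t' = g⁻¹ * (t * t) * g := by rw [ht']; group
      rw [this, htz, mul_assoc, ← h.zc g, ← mul_assoc, inv_mul_cancel, one_mul]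
    set x := t' * t⁻¹ with hx
    have hxH : x ∈ H := H.mul_mem ht'H (H.inv_mem htJ.1)
    have hxα : (⟨x, hxH⟩ : H) ∈ α.ker := by
      rw [MonoidHom.mem_ker]
      have : (⟨x, hxH⟩ : H) = ⟨t', ht'H⟩ * (⟨t, htJ.1⟩ : H)⁻¹ := rfl
      rw [this, map_mul, map_inv, heq, mul_inv_cancel]
    have hx5 : x ^ 5 = 1 := by
      have h1 : orderOf (α ⟨t, htJ.1⟩) = 2 ^ (1 + 1) := by
        have e1 : (⟨t, htJ.1⟩ : H) ^ 2 = ⟨z, hzH⟩ := Subtype.ext ((pow_two t).trans htz)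
        apply orderOf_eq_prime_pow
        · rw [pow_one, ← map_pow, e1]; exact hαz
        · rw [show 2 ^ (1 + 1) = 2 * 2 from rfl, pow_mul, ← map_pow, e1, ← map_pow, pow_two, hzz, map_one]
      have h2 : orderOf (α ⟨t, htJ.1⟩) ∣ Nat.card α.range := by
        have := orderOf_dvd_natCard (⟨α ⟨t, htJ.1⟩, ⟨_, rfl⟩⟩ : α.range)
        rwa [← Subgroup.orderOf_coe] at this
      have h3 := α.ker.card_mul_index
      rw [Subgroup.index_ker, hHc] at h3
      obtain ⟨k, hk⟩ := h2
      rw [h1] at hk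
      have h4 : Nat.card α.ker ∣ 5 := ⟨k, by
        rw [hk] at h3
        have e3 : Nat.card α.ker * (2 ^ (1 + 1) * k) = 4 * (Nat.card α.ker * k) := by ring
        omega⟩
      have h5 : (⟨⟨x, hxH⟩, hxα⟩ : α.ker) ^ 5 = 1 := by
        rw [← orderOf_dvd_iff_pow_eq_one]
        exact (orderOf_dvd_natCard _).trans h4
      exact congrArg (fun y : α.ker => ((y : H) : N)) h5
    -- t inverts x
    have hxt : t' = x * t := by rw [hx]; group
    have h6 : t * x⁻¹ = x * t := by
      rw [hxt, ← htz] at ht'z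
      have h7 : x * t * x = t := by
        have : (x * t * x) * t = t * t := by rw [← ht'z]; group
        exact mul_right_cancel this
      rw [mul_inv_eq_iff_eq_mul]; exact h7.symm
    have h7 : t * (x ^ 3)⁻¹ = x ^ 3 * t := by
      have : t * (x ^ 3)⁻¹ = t * x⁻¹ * x⁻¹ * x⁻¹ := by group
      rw [this, h6, mul_assoc x, h6, ← mul_assoc, mul_assoc (x * x), h6, pow_succ, pow_two, ← mul_assoc]
    have h8 : t' = x ^ 3 * t * (x ^ 3)⁻¹ := by
      rw [mul_assoc, h7, hxt, ← mul_assoc, ← pow_add, show 3 + 3 = 5 + 1 from rfl, pow_add, hx5, one_mul, pow_one]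
    have hcom : (g * x ^ 3) * t = t * (g * x ^ 3) := by
      have : t = g * t' * g⁻¹ := by rw [ht']; group
      have e2 : t * (g * x ^ 3) = (g * t' * g⁻¹) * (g * x ^ 3) := by rw [← this]
      rw [e2, h8]; group
    have hfin : g * x ^ 3 ∈ H := by
      rcases h.cent hq hinv hcom with e | e | e | e
      · rw [e]; exact H.one_mem
      · rw [e]; exact hzH
      · rw [eq_inv_of_mul_eq_one_left e]; exact H.inv_mem htJ.1
      · rw [eq_mul_inv_of_mul_eq e]; exact H.mul_mem hzH (H.inv_mem htJ.1)
    exact hg ((H.mul_mem_cancel_right (H.pow_mem hxH 3)).1 hfin))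
  have := irr_mem_charDegrees ρ hρ
  rwa [hdim, hHi] at this

end F
end KT

namespace KT
open Matrix
open scoped commutatorElement

theorem perfect_map {N Q : Type} [Group N] [Group Q] (hN : commutator N = ⊤) (f : N →* Q)
    (hf : Function.Surjective f) : commutator Q = ⊤ := by
  rw [commutator_def] at hN ⊢
  have := congrArg (Subgroup.map f) hN
  rwa [Subgroup.map_commutator, Subgroup.map_top_of_surjective f hf] at this

section F
variable {F : Type} [Field F] [CharP F 2] [Finite F]

theorem central_case (hq : 4 ≤ Nat.card F) {N : Type} [Group N] [Finite N] (hN : commutator N = ⊤)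
    (π : N →* SL F) (hπ : Function.Surjective π) (hc : ∀ a ∈ π.ker, ∀ g, g * a = a * g)
    (p : ℕ) [hp : Fact p.Prime] (hcard : Nat.card π.ker = p)
    (hst : ∀ n ∈ charDegrees N, Star (Nat.card F) n) : False := by
  have hp1 : 1 < Nat.card π.ker := hcard ▸ hp.1.one_lt
  have : Nontrivial π.ker := Finite.one_lt_card_iff_nontrivial.1 hp1
  obtain ⟨z, hz⟩ := exists_ne (1 : π.ker)
  have ho : orderOf z = p := by
    have h1 : orderOf z ∣ p := hcard ▸ orderOf_dvd_natCard z
    rcases (Nat.dvd_prime hp.1).1 h1 with h | h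
    · exact absurd (orderOf_eq_one_iff.1 h) hz
    · exact h
  have ho' : orderOf (z : N) = p := by rw [Subgroup.orderOf_coe, ho]
  have hp2 := odd_case hq hN π hπ hc p z.2 ho'
  subst hp2
  have hDC : DC F N π (z : N) := by
    refine ⟨hN, hπ, fun a => ⟨fun ha => ?_, ?_⟩, fun h => hz (Subtype.ext h), hc z z.2⟩
    · have h1 : (⟨a, ha⟩ : π.ker) ∈ Subgroup.zpowers z := by
        rw [Subgroup.eq_top_of_card_eq (Subgroup.zpowers z) (by rw [Nat.card_zpowers, ho, hcard])]
        trivial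
      classical
      rw [mem_zpowers_iff_mem_range_orderOf, ho] at h1
      simp only [Finset.mem_image, Finset.mem_range] at h1
      obtain ⟨k, hk, hk'⟩ := h1
      have h2 := congrArg Subtype.val hk'
      simp only [Subgroup.coe_pow] at h2
      rw [← h2]
      interval_cases k
      · left; simp
      · right; simp
    · rintro (rfl | rfl)
      · simp
      · exact z.2
  have hq4 := hDC.q_eq hq
  have h6 := hst 6 (hDC.q4 hq4)
  rw [hq4] at h6
  have := h6.1
  norm_num at this

theorem key (hq : 4 ≤ Nat.card F) {N : Type} [Group N] [Finite N] (hN : commutator N = ⊤)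
    (π : N →* SL F) (hπ : Function.Surjective π) (hsol : Group.IsSolvable π.ker)
    (hst : ∀ n ∈ charDegrees N, Star (Nat.card F) n) : π.ker = ⊥ := by
  by_contra hne
  have : Nontrivial π.ker := (Subgroup.nontrivial_iff_ne_bot _).2 hne
  have hlt := IsSolvable.commutator_lt_top_of_nontrivial π.ker
  set L := π.ker with hL
  have hAn : ∀ g ∈ (⊤ : Subgroup N), ∀ a ∈ L, g⁻¹ * a * g ∈ L := by
    intro g _ a ha
    have h1 := (inferInstance : π.ker.Normal).conj_mem a ha g⁻¹
    rwa [inv_inv] at h1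
  obtain ⟨a, -, ha⟩ := SetLike.exists_of_lt hlt
  obtain ⟨χ, hχ⟩ := char_sep (A := Abelianization L) mul_comm (a := Abelianization.of a) (by
    intro h1
    exact ha ((QuotientGroup.eq_one_iff a).1 h1))
  set l0 : L →* ℂˣ := χ.comp Abelianization.of with hl0
  have hl01 : l0 ≠ 1 := by
    intro h
    apply hχ
    have := DFunLike.congr_fun h a
    exact this
  have hfin : IsOfFinOrder l0 := by
    rw [isOfFinOrder_iff_pow_eq_one]
    refine ⟨Nat.card L, Nat.card_pos, ?_⟩
    ext x
    rw [MonoidHom.pow_apply, ← map_pow, pow_card_eq_one', map_one]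
    rfl
  have ho1 : orderOf l0 ≠ 1 := fun h => hl01 (orderOf_eq_one_iff.1 h)
  set p := (orderOf l0).minFac with hpdef
  have hp : Fact p.Prime := ⟨Nat.minFac_prime ho1⟩
  obtain ⟨k, hk⟩ := (orderOf l0).minFac_dvd
  rw [← hpdef] at hk
  obtain ⟨l, hl⟩ : ∃ l : L →* ℂˣ, ∀ x, l x = (l0 x) ^ k := ⟨l0 ^ k, fun x => rfl⟩
  have hk0 : 0 < k := by
    rcases Nat.eq_zero_or_pos k with h | h
    · rw [h, mul_zero] at hk
      exact absurd hk (hfin.orderOf_pos).ne'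
    · exact h
  have hl1 : l ≠ 1 := by
    intro h
    have h1 : orderOf l0 ∣ k := by
      apply orderOf_dvd_of_pow_eq_one
      apply MonoidHom.ext
      intro x
      rw [MonoidHom.pow_apply, ← hl, h]
    have h2 := Nat.le_of_dvd hk0 h1
    have := hp.1.two_le
    rw [hk] at h2
    nlinarith
  have hlp : ∀ x, l x ^ p = 1 := by
    intro x
    rw [hl, ← pow_mul, mul_comm, ← hk]
    have := DFunLike.congr_fun (pow_orderOf_eq_one l0) x
    exact this
  have hrange : Nat.card l.range = p := by
    have h1 : l.range ≤ rootsOfUnity p ℂ := by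
      rintro _ ⟨x, rfl⟩
      rw [mem_rootsOfUnity]
      exact hlp x
    have : NeZero p := ⟨hp.1.ne_zero⟩
    have h2 : Nat.card l.range ∣ p := by
      have := Subgroup.card_dvd_of_le h1
      rwa [Complex.card_rootsOfUnity] at this
    rcases (Nat.dvd_prime hp.1).1 h2 with h | h
    · exfalso
      apply hl1
      have h3 := Subgroup.card_eq_one.1 h
      ext x
      have : l x ∈ l.range := ⟨x, rfl⟩
      rw [h3, Subgroup.mem_bot] at this
      rw [this]; rfl
    · exact h
  have hinv : ∀ g : N, ∀ a ∈ L, ext0 L l (g⁻¹ * a * g) = ext0 L l a := by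
    intro g a ha
    have h1 : g ∈ stab ⊤ L hAn (ext0 L l) := by
      rw [caseA hq π hπ hst l hAn]; trivial
    exact h1.2 a ha
  set M : Subgroup N := l.ker.map L.subtype with hM
  have hMm : ∀ x, x ∈ M ↔ x ∈ L ∧ ext0 L l x = 1 := by
    intro x
    constructor
    · rintro ⟨y, hy, rfl⟩
      refine ⟨y.2, ?_⟩
      change ext0 L l (y : N) = 1
      rw [ext0_apply l y.2]
      have : l y = 1 := hy
      change ((l y : ℂˣ) : ℂ) = 1
      rw [this]; rfl
    · rintro ⟨hx, h1⟩
      rw [ext0_apply l hx] at h1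
      exact ⟨⟨x, hx⟩, Units.ext h1, rfl⟩
  have hMn : M.Normal := by
    constructor
    intro n hn g
    rw [hMm] at hn ⊢
    have h1 := hAn g⁻¹ trivial n hn.1
    have h2 := hinv g⁻¹ n hn.1
    rw [inv_inv] at h1 h2
    exact ⟨h1, by rw [h2, hn.2]⟩
  have hML : M ≤ π.ker := fun x hx => ((hMm x).1 hx).1
  let π' : N ⧸ M →* SL F := QuotientGroup.lift M π hML
  have hπ' : Function.Surjective π' := by
    intro s
    obtain ⟨x, hx⟩ := hπ s
    exact ⟨(x : N ⧸ M), hx⟩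
  refine central_case hq (perfect_map hN (QuotientGroup.mk' M) (QuotientGroup.mk'_surjective M))
    π' hπ' ?_ p ?_ (fun n hn => hst n (charDegrees_surj (QuotientGroup.mk' M)
      (QuotientGroup.mk'_surjective M) hn))
  · intro a ha g
    obtain ⟨n, rfl⟩ := QuotientGroup.mk'_surjective M a
    obtain ⟨x, rfl⟩ := QuotientGroup.mk'_surjective M g
    have hn : n ∈ L := ha
    rw [← map_mul, ← map_mul]
    refine QuotientGroup.eq.2 ?_
    have e1 : (x * n)⁻¹ * (n * x) = n⁻¹ * (x⁻¹ * n * x) := by group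
    have hn' : n⁻¹ ∈ L := L.inv_mem hn
    have hx' := hAn x trivial n hn
    rw [e1, hMm]
    refine ⟨L.mul_mem hn' hx', ?_⟩
    rw [ext0_mul l hn' hx', hinv x n hn, ← ext0_mul l hn' hn, inv_mul_cancel, ext0_apply l L.one_mem]
    have : (⟨1, L.one_mem⟩ : L) = 1 := rfl
    rw [this, map_one]; rfl
  · have c1 := M.card_mul_index
    have c2 := π'.ker.card_mul_index
    have c3 := L.card_mul_index
    have c4 := l.ker.card_mul_index
    have c5 : Nat.card M = Nat.card l.ker :=
      Subgroup.card_map_of_injective L.subtype_injective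
    rw [Subgroup.index_ker, MonoidHom.range_eq_top.2 hπ', Subgroup.card_top] at c2
    rw [hL, Subgroup.index_ker, MonoidHom.range_eq_top.2 hπ, Subgroup.card_top, ← hL] at c3
    rw [Subgroup.index_ker, hrange] at c4
    have c6 : M.index = Nat.card (N ⧸ M) := rfl
    rw [c6, ← c2, ← c3, ← c4, c5] at c1
    have p1 : 0 < Nat.card l.ker := Nat.card_pos
    have p2 : 0 < Nat.card (SL F) := Nat.card_pos
    have c7 : Nat.card l.ker * (Nat.card π'.ker * Nat.card (SL F)) =
      Nat.card l.ker * (p * Nat.card (SL F)) := by rw [c1, mul_assoc]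
    exact Nat.eq_of_mul_eq_mul_right p2 (Nat.eq_of_mul_eq_mul_left p1 c7)

end F
end KT

namespace KT
open Matrix
open scoped commutatorElement

theorem sol_sup {G : Type} [Group G] (H M : Subgroup G) [M.Normal]
    (hH : Group.IsSolvable H) (hM : Group.IsSolvable M) : Group.IsSolvable ↥(H ⊔ M) := by
  have e : (H ⊔ M).map (QuotientGroup.mk' M) = H.map (QuotientGroup.mk' M) := by
    rw [Subgroup.map_sup, QuotientGroup.map_mk'_self, sup_bot_eq]
  have h1 : Group.IsSolvable ↥(H.map (QuotientGroup.mk' M)) :=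
    Group.isSolvable_of_surjective ((QuotientGroup.mk' M).subgroupMap_surjective H)
  have h2 : Group.IsSolvable ↥((H ⊔ M).map (QuotientGroup.mk' M)) := by rw [e]; exact h1
  refine Group.isSolvable_of_ker_le_range (Subgroup.inclusion (le_sup_right : M ≤ H ⊔ M))
    ((QuotientGroup.mk' M).subgroupMap (H ⊔ M)) ?_
  intro x hx
  have h3 : (QuotientGroup.mk' M) (x : G) = 1 := congrArg Subtype.val hx
  have h4 : (x : G) ∈ M := (QuotientGroup.eq_one_iff _).1 h3
  exact ⟨⟨x, h4⟩, rfl⟩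

theorem sol_rad (G : Type) [Group G] [Finite G] : Group.IsSolvable (solvableRadical G) := by
  have hfin : ({N : Subgroup G | N.Normal ∧ Group.IsSolvable N}).Finite := Set.toFinite _
  obtain ⟨M, hM⟩ := hfin.exists_maximal ⟨⊥, inferInstance, inferInstance⟩
  have hMn := hM.prop.1
  have hMs := hM.prop.2
  have hle : solvableRadical G ≤ M := by
    refine iSup_le ?_
    rintro ⟨H, hHn, hHs⟩
    have h1 : H ⊔ M ≤ M := hM.le_of_ge ⟨Subgroup.sup_normal H M, sol_sup H M hHs hMs⟩ le_sup_right
    exact le_sup_left.trans h1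
  exact Group.isSolvable_of_isSolvable_injective (Subgroup.inclusion_injective hle)

section F
variable {F : Type} [Field F] [CharP F 2] [Finite F]

theorem star_aux {q n a b : ℕ} (hab : a.Coprime b) (hn : ¬ (n.Coprime a ∨ n.Coprime b)) :
    ∃ x y : ℕ, x.Prime ∧ y.Prime ∧ x ≠ y ∧ x ∣ a ∧ y ∣ b ∧ x * y ∣ n := by
  push Not at hn
  obtain ⟨x, hx, hx1, hx2⟩ := Nat.Prime.not_coprime_iff_dvd.1 hn.1
  obtain ⟨y, hy, hy1, hy2⟩ := Nat.Prime.not_coprime_iff_dvd.1 hn.2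
  have hxy : x ≠ y := by
    rintro rfl
    exact Nat.not_coprime_of_dvd_of_dvd hx.one_lt hx2 hy2 hab
  exact ⟨x, y, hx, hy, hxy, hx2, hy2, ((Nat.coprime_primes hx hy).2 hxy).mul_dvd_of_dvd_of_dvd hx1 hy1⟩

theorem star_S (hq : 4 ≤ Nat.card F) {n : ℕ} (hn : n ∈ charDegrees (SL F)) :
    Star (Nat.card F) n := by
  have c1 := cop1 hq
  have c2 := cop2 (F := F)
  have c3 := cop3 hq
  rcases deg_S hq hn with rfl | rfl | rfl | rfl
  · exact ⟨.inl (Nat.coprime_one_left _), .inl (Nat.coprime_one_left _), .inl (Nat.coprime_one_left _)⟩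
  · exact ⟨.inl c1.symm, .inl c1.symm, .inr c3⟩
  · exact ⟨.inr c1, .inr c2, .inl c1⟩
  · exact ⟨.inl c2.symm, .inl c2.symm, .inl c3.symm⟩

theorem star_G (hq : 4 ≤ Nat.card F) {G : Type} [Group G]
    (hind : ∀ x y : ℕ, x.Prime → y.Prime → x ≠ y → x ∣ Nat.card (PSL2 F) → y ∣ Nat.card (PSL2 F) →
      ((∃ n ∈ charDegrees G, x * y ∣ n) ↔ ∃ n ∈ charDegrees (PSL2 F), x * y ∣ n))
    {n : ℕ} (hn : n ∈ charDegrees G) : Star (Nat.card F) n := by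
  have c1 := cop1 hq
  have c2 := cop2 (F := F)
  have c3 := cop3 hq
  have hc : Nat.card (PSL2 F) = (Nat.card F + 1) * ((Nat.card F - 1) * Nat.card F) := by
    rw [← card_S]; exact (Nat.card_congr (pslEquiv (F := F)).toEquiv).symm
  have d1 : Nat.card F ∣ Nat.card (PSL2 F) := hc ▸ ⟨(Nat.card F + 1) * (Nat.card F - 1), by ring⟩
  have d2 : Nat.card F - 1 ∣ Nat.card (PSL2 F) := hc ▸ ⟨(Nat.card F + 1) * Nat.card F, by ring⟩
  have d3 : Nat.card F + 1 ∣ Nat.card (PSL2 F) := hc ▸ ⟨_, rfl⟩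
  have main : ∀ a b : ℕ, a.Coprime b → a ∣ Nat.card (PSL2 F) → b ∣ Nat.card (PSL2 F) →
      (∀ m ∈ charDegrees (SL F), m.Coprime a ∨ m.Coprime b) → n.Coprime a ∨ n.Coprime b := by
    intro a b hab ha hb hS
    by_contra h
    obtain ⟨x, y, hx, hy, hxy, hxa, hyb, hd⟩ := star_aux (q := 0) hab h
    obtain ⟨m, hm, hmd⟩ := (hind x y hx hy hxy (hxa.trans ha) (hyb.trans hb)).1 ⟨n, hn, hd⟩
    have hm' : m ∈ charDegrees (SL F) := charDegrees_equiv pslEquiv hm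
    rcases hS m hm' with h | h
    · exact Nat.not_coprime_of_dvd_of_dvd hx.one_lt ((dvd_mul_right _ _).trans hmd) hxa h
    · exact Nat.not_coprime_of_dvd_of_dvd hy.one_lt ((dvd_mul_left _ _).trans hmd) hyb h
  exact ⟨main _ _ c1 d1 d2 fun m hm => (star_S hq hm).1,
    main _ _ c2 d1 d3 fun m hm => (star_S hq hm).2.1,
    main _ _ c3 d2 d3 fun m hm => (star_S hq hm).2.2⟩

theorem final (hq : 4 ≤ Nat.card F) (G : Type) [Group G] [Finite G]
    (e : (G ⧸ solvableRadical G) ≃* PSL2 F)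
    (hind : ∀ x y : ℕ, x.Prime → y.Prime → x ≠ y → x ∣ Nat.card (PSL2 F) → y ∣ Nat.card (PSL2 F) →
      ((∃ n ∈ charDegrees G, x * y ∣ n) ↔ ∃ n ∈ charDegrees (PSL2 F), x * y ∣ n)) :
    Nonempty (G ≃* PSL2 F × ↥(solvableRadical G)) := by
  set R := solvableRadical G with hR
  have hRs : Group.IsSolvable R := sol_rad G
  have hRn : R.Normal := solvableRadical_normal G
  let φ : G →* SL F :=
    (((e.trans pslEquiv.symm : (G ⧸ R) ≃* SL F) : (G ⧸ R) →* SL F)).comp (QuotientGroup.mk' R)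
  have hφ : Function.Surjective φ :=
    (e.trans pslEquiv.symm).surjective.comp (QuotientGroup.mk'_surjective R)
  have hker : ∀ x, φ x = 1 ↔ x ∈ R := by
    intro x
    change (e.trans pslEquiv.symm) (QuotientGroup.mk' R x) = 1 ↔ _
    rw [EmbeddingLike.map_eq_one_iff]
    exact QuotientGroup.eq_one_iff x
  have hfin : ({N : Subgroup G | N.Normal ∧ N.map φ = ⊤}).Finite := Set.toFinite _
  obtain ⟨N, hN⟩ := hfin.exists_minimal
    ⟨⊤, inferInstance, Subgroup.map_top_of_surjective φ hφ⟩
  have hNn := hN.prop.1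
  have hNm := hN.prop.2
  have hNc : N ≤ ⁅N, N⁆ := by
    refine hN.le_of_le ⟨inferInstance, ?_⟩ (Subgroup.commutator_le_self N)
    rw [Subgroup.map_commutator, hNm, ← commutator_def, perfect_S hq]
  have hNp : commutator N = ⊤ := by
    apply Subgroup.map_injective N.subtype_injective
    rw [commutator_def, Subgroup.map_commutator, ← MonoidHom.range_eq_map, Subgroup.range_subtype]
    exact le_antisymm (Subgroup.commutator_le_self N) hNc
  let π : N →* SL F := φ.comp N.subtype
  have hπ : Function.Surjective π := by
    intro s
    have : s ∈ N.map φ := by rw [hNm]; trivial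
    obtain ⟨x, hx, rfl⟩ := this
    exact ⟨⟨x, hx⟩, rfl⟩
  have hsol : Group.IsSolvable π.ker := by
    let j : π.ker →* R := (N.subtype.comp π.ker.subtype).codRestrict R
      (fun x => (hker _).1 x.2)
    refine Group.isSolvable_of_isSolvable_injective (f := j) ?_
    intro x y h
    exact Subtype.ext (Subtype.ext (congrArg (fun z : R => (z : G)) h))
  have hb := key hq hNp π hπ hsol (by
    intro n hn
    obtain ⟨m, hm, hd⟩ := clifford_dvd N hn
    exact (star_G hq hind hm).of_dvd hd)
  have hinj : Function.Injective π := (MonoidHom.ker_eq_bot_iff π).1 hb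
  let ψ : N ≃* SL F := MulEquiv.ofBijective π ⟨hinj, hπ⟩
  have hdis : Disjoint N R := by
    rw [Subgroup.disjoint_def]
    intro x hx hxR
    have h1 : π ⟨x, hx⟩ = π 1 := by
      rw [map_one]; exact (hker x).2 hxR
    exact congrArg Subtype.val (hinj h1)
  have hcomm : ∀ (m : N) (n : R), Commute (N.subtype m) (R.subtype n) := fun m n =>
    Subgroup.commute_of_normal_of_disjoint N R hNn hRn hdis m n m.2 n.2
  let θ : N × R →* G := MonoidHom.noncommCoprod N.subtype R.subtype hcomm
  have hθ : Function.Bijective θ := by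
    constructor
    · rw [MonoidHom.noncommCoprod_injective]
      refine ⟨N.subtype_injective, R.subtype_injective, ?_⟩
      rw [Subgroup.range_subtype, Subgroup.range_subtype]; exact hdis
    · intro g
      obtain ⟨n, hn⟩ := hπ (φ g)
      have h1 : (n : G)⁻¹ * g ∈ R := by
        rw [← hker, map_mul, map_inv]
        have : φ (n : G) = φ g := hn
        rw [this, inv_mul_cancel]
      refine ⟨(n, ⟨_, h1⟩), ?_⟩
      change (n : G) * ((n : G)⁻¹ * g) = g
      group
  exact ⟨(MulEquiv.ofBijective θ hθ).symm.trans
    (MulEquiv.prodCongr (ψ.trans pslEquiv) (MulEquiv.refl R))⟩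

end F
end KT

theorem stmt7 (f : ℕ) (hf : 2 ≤ f) (G : Type) [Group G] [Finite G]
    (hquot : Nonempty ((G ⧸ solvableRadical G) ≃* PSL2 (GaloisField 2 f)))
    (hind : ∀ x y : ℕ, x.Prime → y.Prime → x ≠ y →
      x ∣ Nat.card (PSL2 (GaloisField 2 f)) → y ∣ Nat.card (PSL2 (GaloisField 2 f)) →
      ((∃ n ∈ charDegrees G, x * y ∣ n) ↔
        ∃ n ∈ charDegrees (PSL2 (GaloisField 2 f)), x * y ∣ n)) :
    Nonempty (G ≃* PSL2 (GaloisField 2 f) × ↥(solvableRadical G)) := by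
  obtain ⟨e⟩ := hquot
  have hc : Nat.card (GaloisField 2 f) = 2 ^ f := GaloisField.card 2 f (by omega)
  have hq : 4 ≤ Nat.card (GaloisField 2 f) := by
    rw [hc]
    calc 4 = 2 ^ 2 := by norm_num
      _ ≤ 2 ^ f := Nat.pow_le_pow_right (by norm_num) hf
  exact KT.final hq G e hind
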